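/- Let k ≥ 1 and K ∈ ℕ with K > C·k²·log k. The number J_{K,k}(M) of integer solutions 1 ≤ x₁, ..., x_K, y₁, ..., y_K ≤ M of the simultaneous system x₁^i + ... + x_K^i = y₁^i + ... + y_K^i for all 1 ≤ i ≤ k satisfies J_{K,k}(M) ≤ C_k · M^{2K − k(k+1)/2}. -/

import Mathlib

noncomputable section TV

open Finset MeasureTheory

/-- The additive character. -/
def ee (x : ℝ) : ℂ := Complex.exp (((2 * Real.pi * x : ℝ) : ℂ) * Complex.I)

lemma ee_norm (x : ℝ) : ‖ee x‖ = 1 := Complex.norm_exp_ofReal_mul_I _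

lemma ee_add (x y : ℝ) : ee (x + y) = ee x * ee y := by
  unfold ee
  rw [← Complex.exp_add]; congr 1; push_cast; ring

lemma ee_zero : ee 0 = 1 := by simp [ee]

lemma ee_int (n : ℤ) : ee n = 1 := by
  unfold ee
  rw [Complex.exp_eq_one_iff]
  exact ⟨n, by push_cast; ring⟩

lemma ee_neg (x : ℝ) : ee (-x) = (starRingEnd ℂ) (ee x) := by
  unfold ee
  rw [← Complex.exp_conj]; congr 1
  rw [map_mul, Complex.conj_ofReal, Complex.conj_I]; push_cast; ring

lemma ee_sum {ι : Type*} (s : Finset ι) (g : ι → ℝ) : ee (∑ i ∈ s, g i) = ∏ i ∈ s, ee (g i) := by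
  classical
  induction s using Finset.induction_on with
  | empty => simp [ee_zero]
  | insert a s ha ih => rw [sum_insert ha, prod_insert ha, ee_add, ih]

lemma ee_cont : Continuous ee := by unfold ee; fun_prop

lemma ee_sub_le (x y : ℝ) : ‖ee x - ee y‖ ≤ 2 * Real.pi * |x - y| := by
  have h : ee x - ee y = ee y * (ee (x - y) - 1) := by
    rw [mul_sub, ← ee_add]; simp
  rw [h, norm_mul, ee_norm, one_mul]
  unfold ee
  have := Real.norm_exp_I_mul_ofReal_sub_one_le (x := 2 * Real.pi * (x - y))
  rw [mul_comm]
  refine this.trans ?_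
  rw [Real.norm_eq_abs, abs_mul, abs_of_pos Real.two_pi_pos]

/-- pairing -/
def ph {k : ℕ} (α : Fin k → ℝ) (v : Fin k → ℤ) : ℝ := ∑ j, α j * v j

lemma ph_add {k : ℕ} (α : Fin k → ℝ) (v w : Fin k → ℤ) : ph α (v + w) = ph α v + ph α w := by
  unfold ph
  rw [← sum_add_distrib]; refine sum_congr rfl fun j _ => ?_
  simp; ring

lemma ph_zero {k : ℕ} (α : Fin k → ℝ) : ph α 0 = 0 := by simp [ph]

lemma ph_neg {k : ℕ} (α : Fin k → ℝ) (v : Fin k → ℤ) : ph α (-v) = - ph α v := by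
  unfold ph
  rw [← sum_neg_distrib]; refine sum_congr rfl fun j _ => ?_
  simp

lemma ph_sum {k : ℕ} {ι : Type*} (s : Finset ι) (α : Fin k → ℝ) (g : ι → Fin k → ℤ) :
    ph α (∑ i ∈ s, g i) = ∑ i ∈ s, ph α (g i) := by
  classical
  induction s using Finset.induction_on with
  | empty => simp [ph_zero]
  | insert a s ha ih => rw [sum_insert ha, sum_insert ha, ph_add, ih]

/-- exponential sum over a finite family -/
def ES {k : ℕ} {ι : Type*} (X : Finset ι) (φ : ι → Fin k → ℤ) (α : Fin k → ℝ) : ℂ :=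
  ∑ x ∈ X, ee (ph α (φ x))

lemma ph_cont {k : ℕ} (v : Fin k → ℤ) : Continuous (fun α : Fin k → ℝ => ph α v) := by
  unfold ph; fun_prop

lemma ES_cont {k : ℕ} {ι : Type*} (X : Finset ι) (φ : ι → Fin k → ℤ) : Continuous (ES X φ) := by
  unfold ES
  exact continuous_finsetSum _ fun x _ => ee_cont.comp (ph_cont _)

lemma ES_norm_le {k : ℕ} {ι : Type*} (X : Finset ι) (φ : ι → Fin k → ℤ) (α : Fin k → ℝ) :
    ‖ES X φ α‖ ≤ X.card := by
  unfold ES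
  refine (norm_sum_le _ _).trans ?_
  simp [ee_norm]

/-- The measure on the cube. -/
def mu (k : ℕ) (c : ℝ) (m : ℕ) : Measure (Fin k → ℝ) :=
  Measure.pi (fun _ => (volume : Measure ℝ).restrict (Set.Ioc c (c + m)))

instance (k : ℕ) (c : ℝ) (m : ℕ) : IsFiniteMeasure (mu k c m) := by unfold mu; infer_instance

lemma mu_eq (k : ℕ) (c : ℝ) (m : ℕ) :
    mu k c m = (volume : Measure (Fin k → ℝ)).restrict (Set.pi Set.univ fun _ => Set.Ioc c (c + m)) := by
  unfold mu
  rw [volume_pi, Measure.restrict_pi_pi]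

lemma int_one (c : ℝ) (m : ℕ) (n : ℤ) :
    ∫ x in Set.Ioc c (c + m), ee (x * n) = if n = 0 then (m : ℂ) else 0 := by
  rw [← intervalIntegral.integral_of_le (by simp)]
  split_ifs with h
  · subst h; simp [ee_zero]
  · have hc : (2 * Real.pi * n * Complex.I : ℂ) ≠ 0 := by
      simp [Real.pi_ne_zero, h]
    have h1 : ∀ x : ℝ, ee (x * n) = Complex.exp ((2 * Real.pi * n * Complex.I : ℂ) * x) := by
      intro x; unfold ee; congr 1; push_cast; ring
    simp_rw [h1]
    rw [integral_exp_mul_complex hc]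
    have : Complex.exp ((2 * Real.pi * n * Complex.I : ℂ) * ((c + m : ℝ) : ℂ)) =
        Complex.exp ((2 * Real.pi * n * Complex.I : ℂ) * (c : ℂ)) := by
      rw [Complex.exp_eq_exp_iff_exists_int]
      exact ⟨n * m, by push_cast; ring⟩
    rw [this]; simp

lemma int_ph {k : ℕ} (c : ℝ) (m : ℕ) (v : Fin k → ℤ) :
    ∫ α, ee (ph α v) ∂(mu k c m) = if v = 0 then (m : ℂ) ^ k else 0 := by
  unfold ph mu
  simp_rw [ee_sum]
  rw [integral_fintype_prod_eq_prod (𝕜 := ℂ) (fun j (x : ℝ) => ee (x * v j))]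
  simp_rw [int_one]
  split_ifs with h
  · subst h; simp
  · obtain ⟨j, hj⟩ : ∃ j, v j ≠ 0 := by
      by_contra! h'; exact h (funext h')
    exact prod_eq_zero (mem_univ j) (by simp [hj])

lemma bdd_integrable {k : ℕ} (c : ℝ) (m : ℕ) {E : Type*} [NormedAddCommGroup E]
    [SecondCountableTopologyEither (Fin k → ℝ) E]
    {g : (Fin k → ℝ) → E} (hg : Continuous g) : Integrable g (mu k c m) := by
  rw [mu_eq]
  have : IsCompact (Set.pi Set.univ fun _ : Fin k => Set.Icc c (c + m)) :=
    isCompact_univ_pi fun _ => isCompact_Icc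
  exact (hg.continuousOn.integrableOn_compact this).mono_set
    (Set.pi_mono fun _ _ => Set.Ioc_subset_Icc_self)

/-- count of coincidences -/
def Cn {k : ℕ} {ι κ : Type*} (X : Finset ι) (φ : ι → Fin k → ℤ) (Y : Finset κ) (ψ : κ → Fin k → ℤ) : ℕ :=
  ((X ×ˢ Y).filter (fun p => φ p.1 = ψ p.2)).card

lemma int_Cn {k : ℕ} {ι κ : Type*} (c : ℝ) (m : ℕ) (X : Finset ι) (φ : ι → Fin k → ℤ) (Y : Finset κ)
    (ψ : κ → Fin k → ℤ) :
    ∫ α, ES X φ α * (starRingEnd ℂ) (ES Y ψ α) ∂(mu k c m) = (m : ℂ) ^ k * Cn X φ Y ψ := by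
  have h1 : ∀ α, ES X φ α * (starRingEnd ℂ) (ES Y ψ α) =
      ∑ p ∈ X ×ˢ Y, ee (ph α (φ p.1 - ψ p.2)) := by
    intro α
    unfold ES
    rw [map_sum, sum_mul_sum, sum_product]
    refine sum_congr rfl fun x _ => sum_congr rfl fun y _ => ?_
    rw [← ee_neg, ← ee_add, sub_eq_add_neg, ph_add, ph_neg]
  simp_rw [h1]
  rw [integral_finsetSum (f := fun (p : ι × κ) α => ee (ph α (φ p.1 - ψ p.2))) _
    (fun p _ => bdd_integrable c m (ee_cont.comp (ph_cont _)))]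
  simp_rw [int_ph, sub_eq_zero]
  rw [← sum_filter, sum_const, Cn]
  simp [mul_comm]

abbrev En {k : ℕ} {ι : Type*} (X : Finset ι) (φ : ι → Fin k → ℤ) : ℕ := Cn X φ X φ

lemma int_En {k : ℕ} {ι : Type*} (c : ℝ) (m : ℕ) (X : Finset ι) (φ : ι → Fin k → ℤ) :
    ∫ α, ‖ES X φ α‖ ^ 2 ∂(mu k c m) = (m : ℝ) ^ k * En X φ := by
  have := int_Cn c m X φ X φ
  have h2 : ∀ α, ES X φ α * (starRingEnd ℂ) (ES X φ α) = ((‖ES X φ α‖ ^ 2 : ℝ) : ℂ) := by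
    intro α; rw [Complex.mul_conj']; push_cast; rfl
  simp_rw [h2] at this
  rw [integral_complex_ofReal] at this
  exact_mod_cast this

lemma Cn_shift {k : ℕ} {ι : Type*} (X : Finset ι) (φ : ι → Fin k → ℤ) (v : Fin k → ℤ) :
    Cn X φ X (fun x => φ x + v) ≤ En X φ := by
  have h1 := int_Cn 0 1 X φ X (fun x => φ x + v)
  have h2 := int_En 0 1 X φ
  have h3 : ‖∫ α, ES X φ α * (starRingEnd ℂ) (ES X (fun x => φ x + v) α) ∂(mu k 0 1)‖ ≤
      ∫ α, ‖ES X φ α‖ ^ 2 ∂(mu k 0 1) := by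
    refine norm_integral_le_of_norm_le (bdd_integrable _ _ ((ES_cont _ _).norm.pow 2)) ?_
    refine Filter.Eventually.of_forall fun α => ?_
    have : ES X (fun x => φ x + v) α = ES X φ α * ee (ph α v) := by
      unfold ES; rw [sum_mul]; refine sum_congr rfl fun x _ => ?_
      rw [ph_add, ee_add]
    rw [this, norm_mul, RCLike.norm_conj, norm_mul, ee_norm, mul_one, sq]
  rw [h1, h2] at h3
  simp at h3
  exact_mod_cast h3

lemma ES_prod {k : ℕ} {ι κ : Type*} (X : Finset ι) (φ : ι → Fin k → ℤ) (Y : Finset κ) (ψ : κ → Fin k → ℤ)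
    (α : Fin k → ℝ) : ES (X ×ˢ Y) (fun p => φ p.1 + ψ p.2) α = ES X φ α * ES Y ψ α := by
  unfold ES
  rw [sum_mul_sum, sum_product]
  simp_rw [ph_add, ee_add]

lemma ES_pow {k : ℕ} {ι : Type*} (n : ℕ) (X : Finset ι) (φ : ι → Fin k → ℤ) (α : Fin k → ℝ) :
    ES (Fintype.piFinset fun _ : Fin n => X) (fun x => ∑ i, φ (x i)) α = ES X φ α ^ n := by
  unfold ES
  simp_rw [ph_sum, ee_sum]
  rw [Finset.sum_prod_piFinset (g := fun _ x => ee (ph α (φ x)))]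
  simp

/-- mean value counts for a set -/
def Jx {k : ℕ} {ι : Type*} (n : ℕ) (X : Finset ι) (φ : ι → Fin k → ℤ) : ℕ :=
  En (Fintype.piFinset fun _ : Fin n => X) (fun x => ∑ i, φ (x i))

lemma int_Jx {k : ℕ} {ι : Type*} (c : ℝ) (m : ℕ) (n : ℕ) (X : Finset ι) (φ : ι → Fin k → ℤ) :
    ∫ α, ‖ES X φ α‖ ^ (2 * n) ∂(mu k c m) = (m : ℝ) ^ k * Jx n X φ := by
  rw [Jx, ← int_En]
  simp_rw [ES_pow, norm_pow]
  congr 1; ext α; ring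

lemma En_mono {k : ℕ} {ι κ : Type*} {X : Finset ι} {φ : ι → Fin k → ℤ} {Y : Finset κ}
    {ψ : κ → Fin k → ℤ} (g : ι → κ) (hg : ∀ x ∈ X, g x ∈ Y) (hi : Set.InjOn g X)
    (h : ∀ x ∈ X, ψ (g x) = φ x) : En X φ ≤ En Y ψ := by
  unfold En Cn
  refine card_le_card_of_injOn (fun p => (g p.1, g p.2)) ?_ ?_
  · intro p hp
    simp only [coe_filter, mem_product, Set.mem_ofPred_eq] at hp ⊢
    exact ⟨⟨hg _ hp.1.1, hg _ hp.1.2⟩, by rw [h _ hp.1.1, h _ hp.1.2, hp.2]⟩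
  · intro p hp p' hp' he
    simp only [coe_filter, mem_product, Set.mem_ofPred_eq] at hp hp'
    simp only [Prod.mk.injEq] at he
    exact Prod.ext (hi hp.1.1 hp'.1.1 he.1) (hi hp.1.2 hp'.1.2 he.2)

lemma En_le_sq {k : ℕ} {ι : Type*} (X : Finset ι) (φ : ι → Fin k → ℤ) : En X φ ≤ X.card ^ 2 := by
  unfold En Cn
  refine (card_filter_le _ _).trans ?_
  rw [card_product, sq]

lemma En_cover {k : ℕ} {ι τ : Type*} [DecidableEq ι] (X : Finset ι) (φ : ι → Fin k → ℤ)
    (T : Finset τ) (Z : τ → Finset ι) (h : ∀ x ∈ X, ∃ t ∈ T, x ∈ Z t) :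
    En X φ ≤ T.card * ∑ t ∈ T, En (Z t) φ := by
  classical
  let A := X.image φ ∪ (T.biUnion Z).image φ
  have key : ∀ W : Finset ι, (∀ x ∈ W, φ x ∈ A) → En W φ = ∑ v ∈ A, (W.filter (fun x => φ x = v)).card ^ 2 := by
    intro W hW
    unfold En Cn
    rw [card_eq_sum_card_fiberwise (f := fun p => φ p.1) (t := A)]
    · refine sum_congr rfl fun v _ => ?_
      rw [sq, ← card_product]
      congr 1
      ext p
      simp only [mem_filter, mem_product]
      constructor
      · rintro ⟨⟨⟨h1, h2⟩, h3⟩, h4⟩; exact ⟨⟨h1, h4⟩, h2, by rw [← h3, h4]⟩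
      · rintro ⟨⟨h1, h4⟩, h2, h5⟩; exact ⟨⟨⟨h1, h2⟩, by rw [h4, h5]⟩, h4⟩
    · intro p hp
      simp only [coe_filter, mem_product, Set.mem_ofPred_eq] at hp
      exact hW _ hp.1.1
  rw [key X (fun x hx => mem_union_left _ (mem_image_of_mem _ hx))]
  have h2 : ∑ t ∈ T, En (Z t) φ = ∑ t ∈ T, ∑ v ∈ A, ((Z t).filter (fun x => φ x = v)).card ^ 2 := by
    refine sum_congr rfl fun t ht => key _ fun x hx => ?_
    exact mem_union_right _ (mem_image_of_mem _ (mem_biUnion.2 ⟨t, ht, hx⟩))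
  rw [h2, sum_comm, mul_sum]
  refine sum_le_sum fun v _ => ?_
  refine le_trans ?_ (sq_sum_le_card_mul_sum_sq)
  refine Nat.pow_le_pow_left ?_ 2
  refine le_trans (card_le_card ?_) (card_biUnion_le (s := T) (t := fun t => (Z t).filter (fun x => φ x = v)))
  intro x hx
  rw [mem_filter] at hx
  obtain ⟨t, ht, hxt⟩ := h x hx.1
  exact mem_biUnion.2 ⟨t, ht, mem_filter.2 ⟨hxt, hx.2⟩⟩

/-- the moment curve -/
def pv (k : ℕ) (x : ℕ) : Fin k → ℤ := fun j => (x : ℤ) ^ ((j : ℕ) + 1)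

abbrev J (k n P : ℕ) : ℕ := Jx n (Icc 1 P) (pv k)

abbrev fs {k : ℕ} (P : ℕ) (α : Fin k → ℝ) : ℂ := ES (Icc 1 P) (pv k) α

lemma fs_norm_le {k : ℕ} (P : ℕ) (α : Fin k → ℝ) : ‖fs P α‖ ≤ P := by
  simpa using ES_norm_le (Icc 1 P) (pv k) α

lemma int_J (k n P : ℕ) (c : ℝ) (m : ℕ) :
    ∫ α, ‖fs P α‖ ^ (2 * n) ∂(mu k c m) = (m : ℝ) ^ k * J k n P := int_Jx c m n _ _

lemma J_trivial (k n P : ℕ) : J k n P ≤ P ^ (2 * n) := by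
  unfold J Jx
  refine (En_le_sq _ _).trans ?_
  simp [← pow_mul, mul_comm]

lemma J_mono_add (k n t P : ℕ) : (J k (n + t) P : ℝ) ≤ (P : ℝ) ^ (2 * t) * J k n P := by
  have h1 := int_J k (n + t) P 0 1
  have h2 := int_J k n P 0 1
  simp only [Nat.cast_one, one_pow, one_mul] at h1 h2
  rw [← h1, ← h2, ← integral_const_mul]
  refine integral_mono (bdd_integrable _ _ ((ES_cont _ _).norm.pow _))
    (bdd_integrable _ _ (((ES_cont _ _).norm.pow _).const_mul _)) fun α => ?_
  simp only
  rw [mul_add, pow_add, mul_comm]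
  gcongr
  exact fs_norm_le _ _

end TV

noncomputable section TV

open Finset MeasureTheory

lemma newton_eq {R : Type*} [CommRing R] {k : ℕ} (x y : Fin k → R)
    (hu : ∀ j : ℕ, 1 ≤ j → j ≤ k → IsUnit (j : R))
    (h : ∀ j : ℕ, 1 ≤ j → j ≤ k → ∑ i, x i ^ j = ∑ i, y i ^ j) (t : R) :
    ∏ i, (t - x i) = ∏ i, (t - y i) := by
  have es : ∀ j ≤ k, MvPolynomial.aeval x (MvPolynomial.esymm (Fin k) R j) =
      MvPolynomial.aeval y (MvPolynomial.esymm (Fin k) R j) := by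
    intro j
    induction j using Nat.strong_induction_on with
    | _ j ih =>
      intro hj
      rcases Nat.eq_zero_or_pos j with rfl | hpos
      · simp [MvPolynomial.esymm_zero]
      · have N := MvPolynomial.mul_esymm_eq_sum (Fin k) R j
        have Nx := congrArg (MvPolynomial.aeval x) N
        have Ny := congrArg (MvPolynomial.aeval y) N
        simp only [map_mul, map_natCast, map_sum, map_pow, map_neg, map_one, MvPolynomial.psum,
          MvPolynomial.aeval_X] at Nx Ny
        apply (hu j hpos hj).mul_left_cancel
        rw [Nx, Ny]
        congr 1
        refine sum_congr rfl fun a ha => ?_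
        simp only [mem_filter, HasAntidiagonal.mem_antidiagonal] at ha
        rw [ih a.1 ha.2 (by omega), h a.2 (by omega) (by omega)]
  have pr : ∀ z : Fin k → R, ∏ i, (t - z i) = ∑ j ∈ range (k + 1),
      (-1) ^ j * (MvPolynomial.aeval z (MvPolynomial.esymm (Fin k) R j) * t ^ (k - j)) := by
    intro z
    have := congrArg (Polynomial.eval t) (Multiset.prod_X_sub_X_eq_sum_esymm (univ.val.map z))
    simp only [Multiset.map_map, Function.comp_def, Multiset.card_map, card_val, card_univ,
      Fintype.card_fin, Polynomial.eval_finsetSum, Polynomial.eval_mul, Polynomial.eval_pow,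
      Polynomial.eval_neg, Polynomial.eval_one, Polynomial.eval_C, Polynomial.eval_X,
      Polynomial.eval_multiset_prod, Polynomial.eval_sub] at this
    simp_rw [MvPolynomial.aeval_esymm_eq_multiset_esymm]
    exact this
  rw [pr, pr]
  refine sum_congr rfl fun j hj => ?_
  rw [es j (by simpa [Nat.lt_succ_iff] using hj)]

lemma linnik_unique {k p m : ℕ} (hp : p.Prime) (hk : k < p) (hm : 1 ≤ m) (x y : Fin k → ℤ)
    (hx : ∀ i j, i ≠ j → ¬ (p : ℤ) ∣ x i - x j)
    (h : ∀ j : ℕ, 1 ≤ j → j ≤ k → ((p ^ m : ℕ) : ℤ) ∣ ∑ i, x i ^ j - ∑ i, y i ^ j) (i : Fin k) :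
    ∃ j, ((p ^ m : ℕ) : ℤ) ∣ y i - x j := by
  have hpz : Prime (p : ℤ) := Nat.prime_iff_prime_int.1 hp
  have key : ((p ^ m : ℕ) : ℤ) ∣ ∏ j, (y i - x j) := by
    rw [← ZMod.intCast_zmod_eq_zero_iff_dvd]
    push_cast
    rw [newton_eq (fun i => (x i : ZMod (p ^ m))) (fun i => (y i : ZMod (p ^ m)))]
    · exact prod_eq_zero (mem_univ i) (by simp)
    · intro j h1 h2
      rw [ZMod.isUnit_iff_coprime]
      apply Nat.Coprime.pow_right
      rw [Nat.coprime_comm, hp.coprime_iff_not_dvd]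
      intro hd; have := Nat.le_of_dvd (by omega) hd; omega
    · intro j h1 h2
      have := (ZMod.intCast_zmod_eq_zero_iff_dvd _ (p ^ m)).2 (h j h1 h2)
      push_cast at this
      exact sub_eq_zero.1 this
  have hd : (p : ℤ) ∣ ∏ j, (y i - x j) := by
    refine dvd_trans ?_ key
    push_cast; exact dvd_pow_self _ (by omega)
  obtain ⟨j, -, hj⟩ := (Prime.dvd_finsetProd_iff hpz _).1 hd
  refine ⟨j, ?_⟩
  rw [← mul_prod_erase univ _ (mem_univ j)] at key
  refine IsCoprime.dvd_of_dvd_mul_right ?_ key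
  push_cast
  apply IsCoprime.pow_left
  apply IsCoprime.prod_right
  intro l hl
  rw [Prime.coprime_iff_not_dvd hpz]
  intro hd2
  apply hx l j (ne_of_mem_erase hl)
  have := dvd_sub hj hd2
  simpa using this

/-- generic tuples -/
def Gk (k p P : ℕ) : Finset (Fin k → ℕ) :=
  (Fintype.piFinset fun _ : Fin k => Icc 1 P).filter
    fun x => ∀ i j, i ≠ j → ¬ (p : ℤ) ∣ (x i : ℤ) - x j

lemma linnik_count {k p P : ℕ} (hp : p.Prime) (hk : k < p) (hk1 : 1 ≤ k) (hP : P ≤ p ^ k) (b : ℕ) (h : Fin k → ℤ) :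
    ((Gk k p P).filter fun x => ∀ j : Fin k, ((p : ℤ) ^ ((j : ℕ) + 1)) ∣
      ∑ i, ((x i : ℤ) + b) ^ ((j : ℕ) + 1) - h j).card ≤ k ^ k * p ^ (k * (k - 1) / 2) := by
  classical
  set S := (Gk k p P).filter fun x => ∀ j : Fin k, ((p : ℤ) ^ ((j : ℕ) + 1)) ∣
      ∑ i, ((x i : ℤ) + b) ^ ((j : ℕ) + 1) - h j with hS
  let g : (Fin k → ℕ) → (Fin k → ℤ) := fun x j =>
    ((∑ i, ((x i : ℤ) + b) ^ ((j : ℕ) + 1) - h j) / (p : ℤ) ^ ((j : ℕ) + 1)) % ((p ^ (k - 1 - j) : ℕ) : ℤ)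
  let T : Finset (Fin k → ℤ) := Fintype.piFinset fun j => Ico 0 ((p ^ (k - 1 - j) : ℕ) : ℤ)
  have hT : T.card = p ^ (k * (k - 1) / 2) := by
    simp only [T, Fintype.card_piFinset, Int.card_Ico, sub_zero, Int.toNat_natCast]
    rw [prod_pow_eq_pow_sum]
    congr 1
    rw [Fin.sum_univ_eq_sum_range (fun j => k - 1 - j) k, sum_range_reflect (fun j => j) k, sum_range_id]
  rw [← hT]
  refine card_le_mul_card_image_of_maps_to (f := g) ?_ (k ^ k) ?_
  · intro x _
    simp only [T, Fintype.mem_piFinset, mem_Ico, g]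
    intro j
    have : (0 : ℤ) < ((p ^ (k - 1 - j) : ℕ) : ℤ) := by have := hp.pos; positivity
    exact ⟨Int.emod_nonneg _ this.ne', Int.emod_lt_of_pos _ this⟩
  · intro v _
    by_cases hne : (S.filter fun x => g x = v).Nonempty
    swap
    · rw [not_nonempty_iff_eq_empty.1 hne]; simp
    obtain ⟨x, hx⟩ := hne
    have hsub : (S.filter fun x => g x = v) ⊆ (univ : Finset (Fin k → Fin k)).image (fun c i => x (c i)) := by
      intro y hy
      rw [mem_filter] at hx hy
      obtain ⟨hxS, hxv⟩ := hx
      obtain ⟨hyS, hyv⟩ := hy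
      rw [hS, mem_filter, Gk, mem_filter] at hxS hyS
      obtain ⟨⟨hx1, hx2⟩, hx3⟩ := hxS
      obtain ⟨⟨hy1, hy2⟩, hy3⟩ := hyS
      have hall : ∀ i, ∃ j, y i = x j := by
        intro i
        have hcong : ∀ j : ℕ, 1 ≤ j → j ≤ k → ((p ^ k : ℕ) : ℤ) ∣ ∑ i, ((x i : ℤ) + b) ^ j - ∑ i, ((y i : ℤ) + b) ^ j := by
          intro j h1 h2
          obtain ⟨l, rfl⟩ : ∃ l, j = l + 1 := ⟨j - 1, by omega⟩
          have e := congrFun (hxv.trans hyv.symm) ⟨l, by omega⟩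
          simp only [g] at e
          obtain ⟨A, hA⟩ := hx3 ⟨l, by omega⟩
          obtain ⟨B, hB⟩ := hy3 ⟨l, by omega⟩
          simp only at hA hB
          have hp0 : ((p : ℤ) ^ (l + 1)) ≠ 0 := by
            have := hp.pos; positivity
          rw [hA, hB, Int.mul_ediv_cancel_left _ hp0, Int.mul_ediv_cancel_left _ hp0] at e
          have e2 : ((p ^ (k - 1 - l) : ℕ) : ℤ) ∣ A - B := Int.ModEq.dvd (Eq.symm e)
          have e3 : (∑ i, ((x i : ℤ) + b) ^ (l + 1)) - ∑ i, ((y i : ℤ) + b) ^ (l + 1) =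
              (p : ℤ) ^ (l + 1) * (A - B) := by linarith
          rw [e3]
          have e4 : ((p ^ k : ℕ) : ℤ) = (p : ℤ) ^ (l + 1) * ((p ^ (k - 1 - l) : ℕ) : ℤ) := by
            push_cast; rw [← pow_add]; congr 1; omega
          rw [e4]
          exact mul_dvd_mul_left _ e2
        obtain ⟨j, hj⟩ := linnik_unique (m := k) hp hk hk1 (fun i => (x i : ℤ) + b) (fun i => (y i : ℤ) + b)
          (by intro i j hij; simpa using hx2 i j hij) hcong i
        refine ⟨j, ?_⟩
        have h1 := Fintype.mem_piFinset.1 hx1 j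
        have h2 := Fintype.mem_piFinset.1 hy1 i
        rw [mem_Icc] at h1 h2
        have hj' : ((p ^ k : ℕ) : ℤ) ∣ (y i : ℤ) - x j := by simpa using hj
        have := Int.eq_zero_of_abs_lt_dvd hj' (by rw [abs_lt]; constructor <;> omega)
        omega
      choose c hc using hall
      exact mem_image.2 ⟨c, mem_univ _, (funext hc).symm⟩
    refine (card_le_card hsub).trans (card_image_le.trans ?_)
    simp

end TV

noncomputable section TV

open Finset MeasureTheory

lemma translate_pow {ι : Type*} [Fintype ι] (k : ℕ) (X Y : ι → ℤ) (b : ℤ)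
    (h : ∀ j < k, ∑ i, X i ^ (j + 1) = ∑ i, Y i ^ (j + 1)) :
    ∀ j < k, ∑ i, (X i + b) ^ (j + 1) = ∑ i, (Y i + b) ^ (j + 1) := by
  intro j hj
  simp_rw [add_pow]
  rw [sum_comm, sum_comm (γ := ι)]
  refine sum_congr rfl fun l hl => ?_
  rw [mem_range] at hl
  simp_rw [mul_assoc, ← sum_mul]
  congr 1
  rcases l with _ | l
  · simp
  · exact h l (by omega)

/-- the residue class of `-b` -/
def Xb (P p b : ℕ) : Finset ℕ := (Icc 1 P).filter fun u => p ∣ u + b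

lemma gen_count {k p P s : ℕ} (hp : p.Prime) (hk : k < p) (hk1 : 1 ≤ k) (hP : P ≤ p ^ k) (b : ℕ) (hb : b < p) :
    En (Gk k p P ×ˢ Fintype.piFinset fun _ : Fin s => Xb P p b)
      (fun q => ∑ i, pv k (q.1 i) + ∑ i, pv k (q.2 i)) ≤
      J k s (P / p + 1) * (k ^ k * p ^ (k * (k - 1) / 2) * P ^ k) := by
  classical
  unfold En Cn
  set U := Fintype.piFinset fun _ : Fin s => Xb P p b with hU
  set φ : (Fin k → ℕ) × (Fin s → ℕ) → Fin k → ℤ := (fun q => ∑ i, pv k (q.1 i) + ∑ i, pv k (q.2 i)) with hφ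
  set A := ((Gk k p P ×ˢ U) ×ˢ (Gk k p P ×ˢ U)).filter (fun q => φ q.1 = φ q.2) with hA
  let h : (Fin k → ℕ) → Fin k → ℤ := fun y j => ∑ i, ((y i : ℤ) + b) ^ ((j : ℕ) + 1)
  let B : Finset ((Fin k → ℕ) × (Fin k → ℕ)) := ((Gk k p P) ×ˢ (Gk k p P)).filter fun q =>
    ∀ j : Fin k, ((p : ℤ) ^ ((j : ℕ) + 1)) ∣ ∑ i, ((q.1 i : ℤ) + b) ^ ((j : ℕ) + 1) - h q.2 j
  have hB : B.card ≤ k ^ k * p ^ (k * (k - 1) / 2) * P ^ k := by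
    have hG : (Gk k p P).card ≤ P ^ k := by
      refine (card_filter_le _ _).trans ?_
      simp
    refine le_trans ?_ (Nat.mul_le_mul_left _ hG)
    refine card_le_mul_card_image_of_maps_to (f := fun q => q.2) ?_ _ ?_
    · intro q hq
      simp only [B, mem_filter, mem_product, Set.mem_ofPred_eq] at hq
      exact hq.1.2
    · intro y _
      refine le_trans ?_ (linnik_count hp hk hk1 hP b (h y))
      refine card_le_card_of_injOn (fun q => q.1) ?_ ?_
      · intro q hq
        simp only [B, coe_filter, mem_filter, mem_product, Set.mem_ofPred_eq] at hq ⊢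
        refine ⟨hq.1.1.1, ?_⟩
        rw [← hq.2]; exact hq.1.2
      · intro q hq q' hq' e
        simp only [coe_filter, mem_filter, Set.mem_ofPred_eq] at hq hq'
        exact Prod.ext e (hq.2.trans hq'.2.symm)
  refine le_trans ?_ (Nat.mul_le_mul_left _ hB)
  have hUdef : ∀ u ∈ U, ∀ i, 1 ≤ u i ∧ u i ≤ P ∧ p ∣ u i + b := by
    intro u hu i
    have := Fintype.mem_piFinset.1 hu i
    rw [Xb, mem_filter, mem_Icc] at this
    tauto
  have hAeq : ∀ q ∈ A, ∀ j : Fin k, ∑ i, ((q.1.1 i : ℤ) + b) ^ ((j : ℕ) + 1) - h q.2.1 j =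
      (p : ℤ) ^ ((j : ℕ) + 1) * (∑ i, (((q.2.2 i + b) / p : ℕ) : ℤ) ^ ((j : ℕ) + 1)
        - ∑ i, (((q.1.2 i + b) / p : ℕ) : ℤ) ^ ((j : ℕ) + 1)) := by
    intro q hq j
    simp only [hA, mem_filter, mem_product] at hq
    obtain ⟨⟨⟨hx, hu⟩, hy, hv⟩, he⟩ := hq
    have t := translate_pow k (Sum.elim (fun i => (q.1.1 i : ℤ)) (fun i => (q.1.2 i : ℤ)))
      (Sum.elim (fun i => (q.2.1 i : ℤ)) (fun i => (q.2.2 i : ℤ))) b ?_ j j.2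
    · simp only [Fintype.sum_sum_type, Sum.elim_inl, Sum.elim_inr] at t
      have e1 : ∀ u ∈ U, ∑ i, ((u i : ℤ) + b) ^ ((j : ℕ) + 1) =
          (p : ℤ) ^ ((j : ℕ) + 1) * ∑ i, (((u i + b) / p : ℕ) : ℤ) ^ ((j : ℕ) + 1) := by
        intro u hu
        rw [mul_sum]
        refine sum_congr rfl fun i _ => ?_
        rw [← mul_pow]; congr 1
        have := Nat.mul_div_cancel' (hUdef u hu i).2.2
        exact_mod_cast this.symm
      rw [e1 _ hu, e1 _ hv] at t
      simp only [h]
      linarith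
    · intro l hl
      have := congrFun he ⟨l, hl⟩
      simp only [hφ, Pi.add_apply, Finset.sum_apply, pv] at this
      simpa only [Fintype.sum_sum_type, Sum.elim_inl, Sum.elim_inr] using this
  refine card_le_mul_card_image_of_maps_to (f := fun q => (q.1.1, q.2.1)) ?_ _ ?_
  · intro q hq
    have hq' := hAeq q hq
    simp only [hA, mem_filter, mem_product, Set.mem_ofPred_eq] at hq
    simp only [B, mem_filter, mem_product, Set.mem_ofPred_eq]
    exact ⟨⟨hq.1.1.1, hq.1.2.1⟩, fun j => ⟨_, hq' j⟩⟩
  · rintro ⟨x, y⟩ -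
    let c : Fin k → ℤ := fun j => (h y j - ∑ i, ((x i : ℤ) + b) ^ ((j : ℕ) + 1)) / (p : ℤ) ^ ((j : ℕ) + 1)
    refine le_trans ?_ (Cn_shift (Fintype.piFinset fun _ : Fin s => Icc 1 (P / p + 1))
      (fun x => ∑ i, pv k (x i)) c)
    unfold Cn
    refine card_le_card_of_injOn (fun q => (fun i => (q.1.2 i + b) / p, fun i => (q.2.2 i + b) / p)) ?_ ?_
    · intro q hq
      have hq0 := (mem_filter.1 hq).1
      have hqe := (mem_filter.1 hq).2
      have hq' := hAeq q hq0
      simp only [Prod.mk.injEq] at hqe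
      simp only [hA, mem_filter, mem_product] at hq0
      have mm : ∀ u ∈ U, (fun i => (u i + b) / p) ∈ Fintype.piFinset fun _ : Fin s => Icc 1 (P / p + 1) := by
        intro u hu
        rw [Fintype.mem_piFinset]
        intro i
        obtain ⟨h1, h2, h3⟩ := hUdef u hu i
        rw [mem_Icc]
        constructor
        · exact Nat.div_pos (Nat.le_of_dvd (by omega) h3) hp.pos
        · rw [← Nat.add_div_right _ hp.pos]
          exact Nat.div_le_div_right (by omega)
      simp only [coe_filter, mem_product, Set.mem_ofPred_eq]
      refine ⟨⟨mm _ hq0.1.1.2, mm _ hq0.1.2.2⟩, ?_⟩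
      ext j
      simp only [Finset.sum_apply, pv, Pi.add_apply, c]
      have hp0 : ((p : ℤ) ^ ((j : ℕ) + 1)) ≠ 0 := by
        have := hp.pos; positivity
      have := hq' j
      rw [hqe.1, hqe.2] at this
      have h2 : h y j - ∑ i, ((x i : ℤ) + b) ^ ((j : ℕ) + 1) = (p : ℤ) ^ ((j : ℕ) + 1) *
        (∑ i, (((q.1.2 i + b) / p : ℕ) : ℤ) ^ ((j : ℕ) + 1)
        - ∑ i, (((q.2.2 i + b) / p : ℕ) : ℤ) ^ ((j : ℕ) + 1)) := by linarith
      rw [h2, Int.mul_ediv_cancel_left _ hp0]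
      ring
    · intro q hq q' hq' e
      have hq0 := (mem_filter.1 hq).1
      have hqe := (mem_filter.1 hq).2
      have hq0' := (mem_filter.1 hq').1
      have hqe' := (mem_filter.1 hq').2
      simp only [hA, mem_filter, mem_product] at hq0 hq0'
      simp only [Prod.mk.injEq] at hqe hqe' e
      have inj : ∀ u ∈ U, ∀ v ∈ U, (fun i => (u i + b) / p) = (fun i => (v i + b) / p) → u = v := by
        intro u hu v hv e
        ext i
        have h1 := Nat.div_mul_cancel (hUdef u hu i).2.2
        have h2 := Nat.div_mul_cancel (hUdef v hv i).2.2
        have h3 := congrFun e i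
        beta_reduce at h3
        rw [h3] at h1
        omega
      exact Prod.ext (Prod.ext (hqe.1.trans hqe'.1.symm) (inj _ hq0.1.1.2 _ hq0'.1.1.2 e.1))
        (Prod.ext (hqe.2.trans hqe'.2.symm) (inj _ hq0.1.2.2 _ hq0'.1.2.2 e.2))

end TV

noncomputable section TV

open Finset MeasureTheory

lemma ES_split {k : ℕ} (P p : ℕ) (hp : 0 < p) (α : Fin k → ℝ) :
    ES (Icc 1 P) (pv k) α = ∑ b ∈ range p, ES (Xb P p b) (pv k) α := by
  unfold ES
  rw [← sum_fiberwise_of_maps_to (s := Icc 1 P) (t := range p) (g := fun u => (p - u % p) % p)]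
  · refine sum_congr rfl fun b hb => ?_
    refine sum_congr ?_ fun _ _ => rfl
    ext u
    rw [Xb, mem_filter, mem_filter]
    refine and_congr_right fun _ => ?_
    rw [mem_range] at hb
    have h1 : u % p < p := Nat.mod_lt _ hp
    have h2 : u = p * (u / p) + u % p := (Nat.div_add_mod u p).symm
    have h3 : p ∣ u + b ↔ p ∣ u % p + b := by
      conv_lhs => rw [h2, add_assoc]
      exact (Nat.dvd_add_right (dvd_mul_right _ _))
    rw [h3]
    generalize u % p = r at *
    rcases Nat.eq_zero_or_pos r with rfl | hr
    · simp
      constructor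
      · rintro rfl; simp
      · intro h; by_contra hne; exact absurd (Nat.le_of_dvd (by omega) h) (by omega)
    · rw [Nat.mod_eq_of_lt (by omega)]
      constructor
      · rintro rfl; rw [Nat.add_sub_cancel' h1.le]
      · intro h
        obtain ⟨c, hc⟩ := h
        have : c = 1 := by
          have h5 : 0 < c := by
            rcases Nat.eq_zero_or_pos c with rfl | h
            · simp at hc; omega
            · exact h
          have h6 : c < 2 := by
            by_contra h7
            have := Nat.mul_le_mul_left p (not_lt.1 h7)
            omega
          omega
        subst this; omega
  · intro u _
    exact mem_range.2 (Nat.mod_lt _ hp)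

lemma gen_int {k p P s : ℕ} (hp : p.Prime) (hk : k < p) (hk1 : 1 ≤ k) (hP : P ≤ p ^ k) (hs : 1 ≤ s) :
    (En (Gk k p P ×ˢ Fintype.piFinset fun _ : Fin s => Icc 1 P)
      (fun q => ∑ i, pv k (q.1 i) + ∑ i, pv k (q.2 i)) : ℝ) ≤
      (p : ℝ) ^ (2 * s) * (J k s (P / p + 1) * (k ^ k * p ^ (k * (k - 1) / 2) * P ^ k) : ℕ) := by
  have key : ∀ X : Finset ℕ, (En (Gk k p P ×ˢ Fintype.piFinset fun _ : Fin s => X)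
      (fun q => ∑ i, pv k (q.1 i) + ∑ i, pv k (q.2 i)) : ℝ) =
      ∫ α, ‖ES (Gk k p P) (fun x => ∑ i, pv k (x i)) α‖ ^ 2 * ‖ES X (pv k) α‖ ^ (2 * s) ∂(mu k 0 1) := by
    intro X
    have := int_En 0 1 (Gk k p P ×ˢ Fintype.piFinset fun _ : Fin s => X)
      (fun q => ∑ i, pv k (q.1 i) + ∑ i, pv k (q.2 i))
    simp only [Nat.cast_one, one_pow, one_mul] at this
    rw [← this]
    congr 1; ext α
    rw [ES_prod (Gk k p P) (fun x => ∑ i, pv k (x i)) (Fintype.piFinset fun _ : Fin s => X)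
      (fun x => ∑ i, pv k (x i)), ES_pow, norm_mul, norm_pow]
    ring
  have hc : ∀ X : Finset ℕ, Continuous fun α => ‖ES (Gk k p P) (fun x => ∑ i, pv k (x i)) α‖ ^ 2 *
      ‖ES X (pv k) α‖ ^ (2 * s) := fun X =>
    ((ES_cont _ _).norm.pow _).mul ((ES_cont _ _).norm.pow _)
  rw [key]
  calc _ ≤ ∫ α, (p : ℝ) ^ (2 * s - 1) * ∑ b ∈ range p,
        (‖ES (Gk k p P) (fun x => ∑ i, pv k (x i)) α‖ ^ 2 * ‖ES (Xb P p b) (pv k) α‖ ^ (2 * s)) ∂(mu k 0 1) := by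
        refine integral_mono (bdd_integrable _ _ (hc _)) (bdd_integrable _ _ ?_) fun α => ?_
        · exact (continuous_finsetSum _ fun b _ => hc _).const_mul _
        · simp only
          rw [← mul_sum, mul_left_comm]
          gcongr
          rw [ES_split P p hp.pos]
          have h1 := pow_sum_le_card_mul_sum_pow (s := range p)
            (f := fun b => ‖ES (Xb P p b) (pv k) α‖) (fun _ _ => norm_nonneg _) (2 * s - 1)
          rw [card_range, Nat.sub_add_cancel (by omega)] at h1
          refine le_trans ?_ h1
          gcongr
          exact norm_sum_le _ _
    _ = (p : ℝ) ^ (2 * s - 1) * ∑ b ∈ range p, (En (Gk k p P ×ˢ Fintype.piFinset fun _ : Fin s => Xb P p b)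
      (fun q => ∑ i, pv k (q.1 i) + ∑ i, pv k (q.2 i)) : ℝ) := by
        rw [integral_const_mul]
        congr 1
        rw [integral_finsetSum (f := fun (b : ℕ) α => ‖ES (Gk k p P) (fun x => ∑ i, pv k (x i)) α‖ ^ 2 * ‖ES (Xb P p b) (pv k) α‖ ^ (2 * s))
          _ (fun b _ => bdd_integrable _ _ (hc _))]
        refine sum_congr rfl fun b _ => (key _).symm
    _ ≤ (p : ℝ) ^ (2 * s - 1) * ∑ b ∈ range p, ((J k s (P / p + 1) * (k ^ k * p ^ (k * (k - 1) / 2) * P ^ k) : ℕ) : ℝ) := by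
        gcongr with b hb
        exact gen_count hp hk hk1 hP b (mem_range.1 hb)
    _ = _ := by
        rw [sum_const, card_range, nsmul_eq_mul, ← mul_assoc, ← pow_succ, Nat.sub_add_cancel (by omega)]

/-- tuples with few distinct values -/
def Dg (k n P : ℕ) : Finset (Fin n → ℕ) :=
  (Fintype.piFinset fun _ : Fin n => Icc 1 P).filter fun x => (univ.image x).card < k

lemma Dg_card (k n P : ℕ) (hn : 1 ≤ n) : (Dg k n P).card ≤ P ^ (k - 1) * (k - 1) ^ n := by
  classical
  have : Dg k n P ⊆ ((Fintype.piFinset fun _ : Fin (k - 1) => Icc 1 P) ×ˢ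
      (univ : Finset (Fin n → Fin (k - 1)))).image (fun q i => q.1 (q.2 i)) := by
    intro x hx
    rw [Dg, mem_filter] at hx
    obtain ⟨hx1, hx2⟩ := hx
    rw [mem_image]
    set S := univ.image x with hS
    have hne : Nonempty S := ⟨⟨x ⟨0, hn⟩, mem_image_of_mem _ (mem_univ _)⟩⟩
    obtain ⟨e⟩ : Nonempty (S ↪ Fin (k - 1)) := by
      apply Function.Embedding.nonempty_of_card_le
      simp; omega
    refine ⟨(fun j => ((Function.invFun (e : S → Fin (k - 1)) j : S) : ℕ), fun i => e ⟨x i, mem_image_of_mem _ (mem_univ _)⟩), ?_, ?_⟩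
    · simp only [mem_product, mem_univ, and_true, Fintype.mem_piFinset]
      intro j
      have := (Function.invFun (e : S → Fin (k - 1)) j).2
      have this := mem_image.1 this
      obtain ⟨i, _, hi⟩ := this
      rw [← hi]
      exact Fintype.mem_piFinset.1 hx1 i
    · ext i
      simp only
      rw [Function.leftInverse_invFun e.injective]
  refine (card_le_card this).trans (card_image_le.trans ?_)
  simp

lemma exists_good_prime {k n P : ℕ} (hk : 2 ≤ k) (S : Finset ℕ) (hS : ∀ p ∈ S, p.Prime ∧ P ≤ p ^ k)
    (hc : S.card = k ^ 3) (x : Fin k → ℕ) (hx : ∀ i, x i ∈ Icc 1 P) (hi : Function.Injective x) :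
    ∃ p ∈ S, x ∈ Gk k p P := by
  by_contra! hcon
  have hP : 1 ≤ P := by
    have := hx ⟨0, by omega⟩
    rw [mem_Icc] at this; omega
  set Q := (univ : Finset (Fin k)).offDiag with hQ
  set D := ∏ q ∈ Q, ((x q.1 : ℤ) - x q.2).natAbs with hD
  have h1 : ∏ p ∈ S, p ∣ D := by
    refine prod_primes_dvd D (fun p hp => (hS p hp).1.prime) fun p hp => ?_
    have := hcon p hp
    rw [Gk, mem_filter] at this
    push Not at this
    obtain ⟨i, j, hij, hd⟩ := this (Fintype.mem_piFinset.2 hx)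
    refine dvd_trans ?_ (dvd_prod_of_mem _ (show (i, j) ∈ Q by simp [hQ, hij]))
    exact Int.natCast_dvd.1 hd
  have hD0 : 0 < D := by
    refine prod_pos fun q hq => ?_
    rw [hQ, mem_offDiag] at hq
    rw [Int.natAbs_pos, sub_ne_zero]
    intro h
    exact hq.2.2 (hi (by exact_mod_cast h))
  have h2 : D ≤ (P - 1) ^ Q.card := by
    rw [hD]
    refine prod_le_pow_card _ _ _ fun q _ => ?_
    have a := hx q.1
    have b := hx q.2
    rw [mem_Icc] at a b
    omega
  have h3 : Q.card = k * k - k := by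
    rw [hQ, offDiag_card]; simp
  have h4 : P ^ (k ^ 3) ≤ (∏ p ∈ S, p) ^ k := by
    rw [← prod_pow, ← hc]
    exact pow_card_le_prod _ _ _ fun p hp => (hS p hp).2
  have h5 : (∏ p ∈ S, p) ≤ D := Nat.le_of_dvd hD0 h1
  have hkk : k + k ≤ k * k := by nlinarith
  have h6 : D < P ^ (k * k) := by
    refine h2.trans_lt ?_
    rw [h3]
    calc (P - 1) ^ (k * k - k) < P ^ (k * k - k) := Nat.pow_lt_pow_left (by omega) (by omega)
      _ ≤ P ^ (k * k) := Nat.pow_le_pow_right hP (by omega)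
  have h7 : P ^ (k ^ 3) < P ^ (k ^ 3) := by
    calc P ^ (k ^ 3) ≤ (∏ p ∈ S, p) ^ k := h4
      _ ≤ D ^ k := Nat.pow_le_pow_left h5 _
      _ < (P ^ (k * k)) ^ k := Nat.pow_lt_pow_left h6 (by omega)
      _ = P ^ (k ^ 3) := by rw [← pow_mul]; congr 1; ring
  exact lt_irrefl _ h7

lemma perm_En {k p P s : ℕ} (I : Fin k ↪ Fin (k + s)) :
    En ((Fintype.piFinset fun _ : Fin (k + s) => Icc 1 P).filter fun x => (fun i => x (I i)) ∈ Gk k p P)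
      (fun x => ∑ i, pv k (x i)) ≤
    En (Gk k p P ×ˢ Fintype.piFinset fun _ : Fin s => Icc 1 P)
      (fun q => ∑ i, pv k (q.1 i) + ∑ i, pv k (q.2 i)) := by
  obtain ⟨σ, hσ⟩ := Equiv.Perm.exists_extending_pair (fun i : Fin k => Fin.castAdd s i) I
    (Fin.castAdd_injective _ _) I.injective
  refine En_mono (fun x => (fun i => x (I i), fun i => x (σ (Fin.natAdd k i)))) ?_ ?_ ?_
  · intro x hx
    rw [mem_filter] at hx
    rw [mem_product]
    refine ⟨hx.2, Fintype.mem_piFinset.2 fun i => Fintype.mem_piFinset.1 hx.1 _⟩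
  · intro x _ y _ e
    simp only [Prod.mk.injEq] at e
    ext i
    obtain ⟨j, rfl⟩ := σ.surjective i
    induction j using Fin.addCases with
    | left j => rw [hσ]; exact congrFun e.1 j
    | right j => exact congrFun e.2 j
  · intro x _
    simp only
    rw [← Equiv.sum_comp σ (fun i => pv k (x i)), Fin.sum_univ_add]
    simp_rw [hσ]

lemma vmvt_step (k s : ℕ) (hk : 2 ≤ k) (hs : 1 ≤ s) : ∃ C : ℝ, 0 < C ∧ ∀ (P : ℕ) (S : Finset ℕ) (B : ℝ), 0 ≤ B →
    (∀ p ∈ S, p.Prime ∧ k < p ∧ P ≤ p ^ k) → S.card = k ^ 3 →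
    (∀ p ∈ S, (p : ℝ) ^ (2 * s) * (J k s (P / p + 1) * (k ^ k * p ^ (k * (k - 1) / 2) * P ^ k) : ℕ) ≤ B) →
    (J k (k + s) P : ℝ) ≤ C * ((P : ℝ) ^ (2 * (k - 1)) + B) := by
  classical
  set N : ℕ := (univ : Finset (Option (Fin (k ^ 3) × (Fin k ↪ Fin (k + s))))).card with hN
  refine ⟨N * (((k - 1 : ℕ) : ℝ) ^ (2 * (k + s)) + N) + 1, by positivity, ?_⟩
  intro P S B hB hS hc hSB
  let e : Fin (k ^ 3) ≃ S := (finCongr hc.symm).trans S.equivFin.symm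
  let Z : Option (Fin (k ^ 3) × (Fin k ↪ Fin (k + s))) → Finset (Fin (k + s) → ℕ) := fun t =>
    match t with
    | none => Dg k (k + s) P
    | some (q, I) => (Fintype.piFinset fun _ : Fin (k + s) => Icc 1 P).filter
        fun x => (fun i => x (I i)) ∈ Gk k (e q) P
  have cov := En_cover (Fintype.piFinset fun _ : Fin (k + s) => Icc 1 P) (fun x => ∑ i, pv k (x i)) univ Z ?_
  · rw [← hN, Fintype.sum_option] at cov
    have c2 : (J k (k + s) P : ℝ) ≤ N * ((En (Z none) (fun x => ∑ i, pv k (x i)) : ℝ) +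
      ∑ t, (En (Z (some t)) (fun x => ∑ i, pv k (x i)) : ℝ)) := by
      unfold J Jx
      exact_mod_cast cov
    have hD : (En (Z none) (fun x => ∑ i, pv k (x i)) : ℝ) ≤ ((k - 1 : ℕ) : ℝ) ^ (2 * (k + s)) * (P : ℝ) ^ (2 * (k - 1)) := by
      have h1 := (En_le_sq (Z none) (fun x => ∑ i, pv k (x i))).trans
        (Nat.pow_le_pow_left (Dg_card k (k + s) P (by omega)) 2)
      have h2 : (En (Z none) (fun x => ∑ i, pv k (x i)) : ℝ) ≤ (((P ^ (k - 1) * (k - 1) ^ (k + s)) ^ 2 : ℕ) : ℝ) := by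
        exact_mod_cast h1
      refine h2.trans (le_of_eq ?_)
      push_cast
      ring
    have hG : ∑ t, (En (Z (some t)) (fun x => ∑ i, pv k (x i)) : ℝ) ≤ N * B := by
      have : ∀ t ∈ (univ : Finset (Fin (k ^ 3) × (Fin k ↪ Fin (k + s)))),
          (En (Z (some t)) (fun x => ∑ i, pv k (x i)) : ℝ) ≤ B := by
        rintro ⟨q, I⟩ -
        have hp := hS (e q) (e q).2
        refine le_trans ?_ (hSB (e q) (e q).2)
        refine le_trans ?_ (gen_int hp.1 hp.2.1 (by omega) hp.2.2 hs)
        exact_mod_cast perm_En I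
      refine (sum_le_card_nsmul _ _ _ this).trans ?_
      rw [nsmul_eq_mul]
      gcongr
      rw [hN, card_univ, card_univ, Fintype.card_option]; omega
    refine c2.trans ?_
    have hP0 : (0 : ℝ) ≤ (P : ℝ) ^ (2 * (k - 1)) := by positivity
    have hk0 : (0 : ℝ) ≤ ((k - 1 : ℕ) : ℝ) ^ (2 * (k + s)) := by positivity
    have hN0 : (0 : ℝ) ≤ N := by positivity
    calc _ ≤ (N : ℝ) * (((k - 1 : ℕ) : ℝ) ^ (2 * (k + s)) * (P : ℝ) ^ (2 * (k - 1)) + N * B) := by gcongr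
      _ ≤ _ := by
        have h1 := mul_nonneg (mul_nonneg hN0 hk0) hB
        have h2 := mul_nonneg (mul_nonneg hN0 hN0) hP0
        nlinarith
  · intro x hx
    by_cases hxD : (univ.image x).card < k
    · exact ⟨none, mem_univ _, mem_filter.2 ⟨hx, hxD⟩⟩
    · obtain ⟨I⟩ : Nonempty (Fin k ↪ (univ.image x)) := by
        apply Function.Embedding.nonempty_of_card_le
        simp; omega
      have ch : ∀ i, ∃ j, x j = I i := by
        intro i
        have := (I i).2
        rw [mem_image] at this
        obtain ⟨j, _, hj⟩ := this
        exact ⟨j, hj⟩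
      choose c hcx using ch
      have cinj : Function.Injective c := by
        intro a b hab
        apply I.injective
        apply Subtype.ext
        rw [← hcx, ← hcx, hab]
      obtain ⟨p, hpS, hpG⟩ := exists_good_prime (n := k) hk S (fun p hp => ⟨(hS p hp).1, (hS p hp).2.2⟩) hc
        (fun i => x (c i)) (fun i => Fintype.mem_piFinset.1 hx _) (by
          intro a b hab
          simp only [hcx] at hab
          exact I.injective (Subtype.ext hab))
      refine ⟨some (e.symm ⟨p, hpS⟩, ⟨c, cinj⟩), mem_univ _, ?_⟩
      simp only [Z, mem_filter]
      refine ⟨hx, ?_⟩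
      simpa using hpG

end TV

noncomputable section TV

open Finset MeasureTheory

lemma exists_primes (n Y : ℕ) (hY : 1 ≤ Y) : ∃ S : Finset ℕ, S.card = n ∧
    ∀ p ∈ S, p.Prime ∧ Y < p ∧ p ≤ 2 ^ n * Y := by
  induction n with
  | zero => exact ⟨∅, by simp⟩
  | succ n ih =>
    obtain ⟨S, hS, h⟩ := ih
    have hpos : 1 ≤ 2 ^ n := Nat.one_le_two_pow
    obtain ⟨p, hp, h1, h2⟩ := Nat.exists_prime_lt_and_le_two_mul (2 ^ n * Y) (by positivity)
    refine ⟨insert p S, ?_, ?_⟩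
    · rw [card_insert_of_notMem, hS]
      intro hps
      have := (h p hps).2.2
      omega
    · intro q hq
      rw [mem_insert] at hq
      rcases hq with rfl | hq
      · refine ⟨hp, ?_, ?_⟩
        · nlinarith
        · rw [pow_succ]; nlinarith
      · obtain ⟨a, b, c⟩ := h q hq
        refine ⟨a, b, ?_⟩
        rw [pow_succ]; nlinarith

def kap (k : ℕ) : ℝ := (k : ℝ) * (k + 1) / 2

lemma kap_sub (k : ℕ) (hk : 1 ≤ k) : ((k * (k - 1) / 2 : ℕ) : ℝ) = (k : ℝ) ^ 2 - kap k := by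
  have h2 : 2 ∣ k * (k - 1) := (Nat.even_mul_pred_self k).two_dvd
  rw [Nat.cast_div h2 (by norm_num)]
  push_cast [Nat.cast_sub hk]
  unfold kap; ring

lemma kap_nat (k : ℕ) : ((k * (k + 1) / 2 : ℕ) : ℝ) = kap k := by
  have h2 : 2 ∣ k * (k + 1) := (Nat.even_mul_succ_self k).two_dvd
  rw [Nat.cast_div h2 (by norm_num)]
  push_cast
  unfold kap; ring

def Bd (k s : ℕ) (η : ℝ) : Prop :=
  ∃ C : ℝ, 0 < C ∧ ∀ P : ℕ, 1 ≤ P → (J k s P : ℝ) ≤ C * (P : ℝ) ^ (2 * (s : ℝ) - kap k + η)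

lemma Bd_step {k s : ℕ} {η : ℝ} (hk : 2 ≤ k) (hs : k ^ 2 ≤ s) (h0 : 0 ≤ η) (h1 : η ≤ kap k) (h : Bd k s η) :
    Bd k (k + s) (η * (1 - 1 / k)) := by
  obtain ⟨C, hC, hJ⟩ := h
  have hk' : (2 : ℝ) ≤ k := by exact_mod_cast hk
  have hs' : (k : ℝ) ^ 2 ≤ s := by exact_mod_cast hs
  have hs1 : 1 ≤ s := le_trans (by nlinarith) hs
  obtain ⟨C1, hC1, hst⟩ := vmvt_step k s hk hs1
  have hkk : kap k ≤ (k : ℝ) ^ 2 := by unfold kap; nlinarith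
  set D : ℝ := 2 ^ (k ^ 3) * (k + 2) with hD
  have hD1 : 1 ≤ D := by
    have : (1 : ℝ) ≤ 2 ^ (k ^ 3) := one_le_pow₀ (by norm_num)
    nlinarith
  set E : ℝ := 2 * (s : ℝ) - kap k + η with hE
  have hE0 : 0 ≤ E := by nlinarith
  set C2 : ℝ := C * (1 + D) ^ E * (k : ℝ) ^ k * D ^ ((k : ℝ) ^ 2 - η) with hC2
  have hC20 : 0 < C2 := by positivity
  refine ⟨C1 * (1 + C2), by positivity, ?_⟩
  intro P hP
  have hP' : (1 : ℝ) ≤ P := by exact_mod_cast hP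
  have hP0 : (0 : ℝ) < P := by linarith
  set T : ℝ := (P : ℝ) ^ (1 / (k : ℝ)) with hT
  have hT1 : 1 ≤ T := Real.one_le_rpow hP' (by positivity)
  have hTP : T ≤ P := by
    calc T ≤ (P : ℝ) ^ (1 : ℝ) := Real.rpow_le_rpow_of_exponent_le hP' (by rw [div_le_one (by linarith)]; linarith)
      _ = P := Real.rpow_one _
  have hTk : T ^ k = P := by
    rw [hT, ← Real.rpow_natCast, ← Real.rpow_mul hP0.le, one_div_mul_cancel (by positivity), Real.rpow_one]
  obtain ⟨S, hS, hSp⟩ := exists_primes (k ^ 3) (⌈T⌉₊ + k) (by omega)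
  set F : ℝ := 2 * ((k + s : ℕ) : ℝ) - kap k + η * (1 - 1 / k) with hF
  have hpD : ∀ p ∈ S, (p : ℝ) ≤ D * T := by
    intro p hp
    have h3 : (p : ℝ) ≤ 2 ^ (k ^ 3) * (⌈T⌉₊ + k) := by exact_mod_cast (hSp p hp).2.2
    have h4 := (Nat.ceil_lt_add_one (by linarith : (0 : ℝ) ≤ T)).le
    refine h3.trans ?_
    rw [hD, mul_assoc]
    gcongr
    nlinarith
  have main := hst P S (C2 * (P : ℝ) ^ F) (by positivity) ?_ hS ?_
  · refine main.trans ?_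
    have : (P : ℝ) ^ (2 * (k - 1)) ≤ (P : ℝ) ^ F := by
      rw [← Real.rpow_natCast]
      refine Real.rpow_le_rpow_of_exponent_le hP' ?_
      push_cast [Nat.cast_sub (show 1 ≤ k by omega)]
      rw [hF]; push_cast
      have : 0 ≤ η * (1 - 1 / (k : ℝ)) := mul_nonneg h0 (by
        rw [sub_nonneg, div_le_one (by linarith)]; linarith)
      nlinarith
    calc _ ≤ C1 * ((P : ℝ) ^ F + C2 * (P : ℝ) ^ F) := by gcongr
      _ = _ := by ring
  · intro p hp
    obtain ⟨a, b, c⟩ := hSp p hp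
    refine ⟨a, by omega, ?_⟩
    have : T ≤ p := by
      refine (Nat.le_ceil T).trans ?_
      exact_mod_cast (by omega : ⌈T⌉₊ ≤ p)
    have h4 : (P : ℝ) ≤ (p : ℝ) ^ k := by
      rw [← hTk]; gcongr
    exact_mod_cast h4
  · intro p hp
    obtain ⟨a, b, c⟩ := hSp p hp
    have hp0 : (0 : ℝ) < p := by exact_mod_cast a.pos
    have hpd := hpD p hp
    have h5 : ((P / p + 1 : ℕ) : ℝ) ≤ (1 + D) * (P / p) := by
      push_cast
      have h6 : ((P / p : ℕ) : ℝ) ≤ P / p := Nat.cast_div_le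
      have h7 : 1 ≤ D * (P / p) := by
        rw [← mul_div_assoc, le_div_iff₀ hp0]
        nlinarith
      linarith
    have h8 : (J k s (P / p + 1) : ℝ) ≤ C * ((1 + D) * (P / p)) ^ E := by
      refine (hJ _ (Nat.succ_pos _)).trans ?_
      gcongr
    push_cast
    have e1 : (p : ℝ) ^ (2 * s) = (p : ℝ) ^ (2 * (s : ℝ)) := by
      rw [← Real.rpow_natCast]; push_cast; rfl
    have e2 : (p : ℝ) ^ (k * (k - 1) / 2) = (p : ℝ) ^ ((k : ℝ) ^ 2 - kap k) := by
      rw [← Real.rpow_natCast, kap_sub k (by omega)]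
    have e3 : (P : ℝ) ^ k = (P : ℝ) ^ (k : ℝ) := by rw [Real.rpow_natCast]
    calc (p : ℝ) ^ (2 * s) * ((J k s (P / p + 1) : ℝ) * ((k : ℝ) ^ k * (p : ℝ) ^ (k * (k - 1) / 2) * (P : ℝ) ^ k))
        ≤ (p : ℝ) ^ (2 * s) * ((C * ((1 + D) * (P / p)) ^ E) * ((k : ℝ) ^ k * (p : ℝ) ^ (k * (k - 1) / 2) * (P : ℝ) ^ k)) := by gcongr
      _ = C * (1 + D) ^ E * (k : ℝ) ^ k * ((P : ℝ) ^ E * (P : ℝ) ^ (k : ℝ)) * ((p : ℝ) ^ (2 * (s : ℝ)) * (p : ℝ) ^ ((k : ℝ) ^ 2 - kap k) / (p : ℝ) ^ E) := by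
          rw [Real.mul_rpow (by positivity) (by positivity), Real.div_rpow hP0.le hp0.le, e1, e2, e3]
          ring
      _ = C * (1 + D) ^ E * (k : ℝ) ^ k * (P : ℝ) ^ (E + k) * (p : ℝ) ^ ((k : ℝ) ^ 2 - η) := by
          rw [← Real.rpow_add hP0, ← Real.rpow_add hp0, ← Real.rpow_sub hp0]
          congr 2; rw [hE]; ring
      _ ≤ C * (1 + D) ^ E * (k : ℝ) ^ k * (P : ℝ) ^ (E + k) * (D * T) ^ ((k : ℝ) ^ 2 - η) := by
          gcongr
          linarith
      _ = C2 * ((P : ℝ) ^ (E + k) * (P : ℝ) ^ (1 / (k : ℝ) * ((k : ℝ) ^ 2 - η))) := by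
          rw [Real.mul_rpow (by positivity) (by positivity), hT, ← Real.rpow_mul hP0.le, hC2]
          ring
      _ = C2 * (P : ℝ) ^ F := by
          rw [← Real.rpow_add hP0]
          congr 2
          rw [hE, hF]; push_cast
          field_simp
          ring

lemma Bd_start (k : ℕ) : Bd k (k ^ 2) (kap k) := by
  refine ⟨1, one_pos, fun P hP => ?_⟩
  rw [one_mul]
  have : (J k (k ^ 2) P : ℝ) ≤ (P : ℝ) ^ (2 * k ^ 2) := by exact_mod_cast J_trivial k (k ^ 2) P
  refine this.trans (le_of_eq ?_)
  rw [← Real.rpow_natCast]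
  congr 1; push_cast; ring

lemma Bd_iter (k m : ℕ) (hk : 2 ≤ k) : Bd k (k ^ 2 + k * m) (kap k * (1 - 1 / (k : ℝ)) ^ m) := by
  have hk' : (2 : ℝ) ≤ k := by exact_mod_cast hk
  have hkap : 0 ≤ kap k := by unfold kap; positivity
  have h01 : 0 ≤ 1 - 1 / (k : ℝ) := by rw [sub_nonneg, div_le_one (by linarith)]; linarith
  have h11 : 1 - 1 / (k : ℝ) ≤ 1 := by
    have : 0 ≤ 1 / (k : ℝ) := by positivity
    linarith
  induction m with
  | zero => simpa using Bd_start k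
  | succ m ih =>
    have := Bd_step hk (by omega) (by positivity) (by
      have : (1 - 1 / (k : ℝ)) ^ m ≤ 1 := pow_le_one₀ h01 h11
      nlinarith) ih
    rw [pow_succ (1 - 1 / (k : ℝ)), ← mul_assoc]
    rwa [show k ^ 2 + k * (m + 1) = k + (k ^ 2 + k * m) by ring]

lemma Bd_mono {k s : ℕ} {η η' : ℝ} (h : η ≤ η') (hb : Bd k s η) : Bd k s η' := by
  obtain ⟨C, hC, hJ⟩ := hb
  refine ⟨C, hC, fun P hP => (hJ P hP).trans ?_⟩
  have hP' : (1 : ℝ) ≤ P := by exact_mod_cast hP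
  gcongr

/-- mean value theorem with exponent excess `1/k^A` and `s ≪ k^2 log k` variables -/
lemma vmvt_weak (A : ℕ) : ∃ c : ℕ, 0 < c ∧ ∀ k : ℕ, 2 ≤ k → ∃ s : ℕ, k ^ 2 ≤ s ∧
    (s : ℝ) ≤ c * (k : ℝ) ^ 2 * Real.log k ∧ Bd k s (1 / (k : ℝ) ^ A) := by
  refine ⟨A + 6, by omega, fun k hk => ?_⟩
  have hk' : (2 : ℝ) ≤ k := by exact_mod_cast hk
  have hk0 : (0 : ℝ) < k := by linarith
  have hl2 : Real.log 2 ≤ Real.log k := Real.log_le_log (by norm_num) hk'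
  have hl : (0.69 : ℝ) < Real.log k := by have := Real.log_two_gt_d9; linarith
  set m := ⌈(A + 2 : ℝ) * k * Real.log k⌉₊ with hm
  have hm1 : (A + 2 : ℝ) * k * Real.log k ≤ m := Nat.le_ceil _
  have hm2 : (m : ℝ) ≤ (A + 2 : ℝ) * k * Real.log k + 1 := (Nat.ceil_lt_add_one (by positivity)).le
  refine ⟨k ^ 2 + k * m, by omega, ?_, Bd_mono ?_ (Bd_iter k m hk)⟩
  · push_cast
    have a1 : (k : ℝ) * m ≤ k * ((A + 2 : ℝ) * k * Real.log k + 1) := by gcongr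
    have a2 : (k : ℝ) ^ 2 * 0.69 ≤ (k : ℝ) ^ 2 * Real.log k := by gcongr
    nlinarith
  · have h01 : 0 ≤ 1 - 1 / (k : ℝ) := by rw [sub_nonneg, div_le_one (by linarith)]; linarith
    have e1 : (1 - 1 / (k : ℝ)) ^ m ≤ 1 / (k : ℝ) ^ (A + 2) := by
      calc (1 - 1 / (k : ℝ)) ^ m ≤ (Real.exp (-(1 / (k : ℝ)))) ^ m := by
            gcongr
            have := Real.add_one_le_exp (-(1 / (k : ℝ)))
            linarith
        _ = Real.exp (-(m / k)) := by rw [← Real.exp_nat_mul]; congr 1; ring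
        _ ≤ Real.exp (-((A + 2 : ℕ) * Real.log k)) := by
            rw [Real.exp_le_exp, neg_le_neg_iff, le_div_iff₀ hk0]
            push_cast
            linarith
        _ = 1 / (k : ℝ) ^ (A + 2) := by
            rw [Real.exp_neg, Real.exp_nat_mul, Real.exp_log hk0, one_div]
    calc kap k * (1 - 1 / (k : ℝ)) ^ m ≤ (k : ℝ) ^ 2 * (1 / (k : ℝ) ^ (A + 2)) := by
          gcongr
          unfold kap; nlinarith
      _ = 1 / (k : ℝ) ^ A := by rw [pow_add]; field_simp

end TV

noncomputable section TV

open Finset MeasureTheory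

/-- `x` is within `e` of an integer -/
def nz (x e : ℝ) : Prop := ∃ n : ℤ, |x - n| ≤ e

lemma nz.mono {x e e' : ℝ} (h : nz x e) (he : e ≤ e') : nz x e' := by
  obtain ⟨n, hn⟩ := h
  exact ⟨n, hn.trans he⟩

lemma nz.add {x y e e' : ℝ} (h : nz x e) (h' : nz y e') : nz (x + y) (e + e') := by
  obtain ⟨n, hn⟩ := h
  obtain ⟨m, hm⟩ := h'
  refine ⟨n + m, ?_⟩
  push_cast
  rw [add_sub_add_comm]
  exact (abs_add_le _ _).trans (add_le_add hn hm)

lemma nz.mul_int {x e : ℝ} (h : nz x e) (m : ℤ) : nz (m * x) (|(m : ℝ)| * e) := by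
  obtain ⟨n, hn⟩ := h
  refine ⟨m * n, ?_⟩
  push_cast
  rw [← mul_sub, abs_mul]
  gcongr

lemma nz.neg {x e : ℝ} (h : nz x e) : nz (-x) e := by
  have := h.mul_int (-1)
  simpa using this

lemma nz_sum {ι : Type*} (s : Finset ι) (f e : ι → ℝ) (h : ∀ i ∈ s, nz (f i) (e i)) :
    nz (∑ i ∈ s, f i) (∑ i ∈ s, e i) := by
  classical
  induction s using Finset.induction_on with
  | empty => exact ⟨0, by simp⟩
  | insert a s ha ih =>
    rw [sum_insert ha, sum_insert ha]
    exact (h a (mem_insert_self _ _)).add (ih fun i hi => h i (mem_insert_of_mem hi))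

lemma sum_Icc_range {E : Type*} [AddCommMonoid E] (F : ℕ → E) (P : ℕ) : ∑ x ∈ Icc 1 P, F x = ∑ i ∈ range P, F (i + 1) := by
  induction P with
  | zero => simp
  | succ P ih => rw [sum_Icc_succ_top (by omega), ih, sum_range_succ]

lemma shift_sum (F : ℕ → ℂ) (hF : ∀ x, ‖F x‖ ≤ 1) (P h : ℕ) :
    ‖∑ x ∈ Icc 1 P, F (x + h) - ∑ x ∈ Icc 1 P, F x‖ ≤ 2 * h := by
  induction h with
  | zero => simp
  | succ h ih =>
    have : ∑ x ∈ Icc 1 P, F (x + (h + 1)) - ∑ x ∈ Icc 1 P, F (x + h) = F (P + 1 + h) - F (1 + h) := by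
      rw [sum_Icc_range, sum_Icc_range, ← sum_sub_distrib]
      have := Finset.sum_range_sub (fun i => F (i + 1 + h)) P
      simpa [add_assoc, add_comm, add_left_comm] using this
    have e : ∑ x ∈ Icc 1 P, F (x + (h + 1)) - ∑ x ∈ Icc 1 P, F x =
      (F (P + 1 + h) - F (1 + h)) + (∑ x ∈ Icc 1 P, F (x + h) - ∑ x ∈ Icc 1 P, F x) := by
      rw [← this]; ring
    rw [e]
    refine (norm_add_le _ _).trans ?_
    have := norm_sub_le (F (P + 1 + h)) (F (1 + h))
    have a := hF (P + 1 + h)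
    have b := hF (1 + h)
    push_cast
    linarith

def sh {k : ℕ} (h : ℕ) (α : Fin k → ℝ) : Fin k → ℝ := fun j =>
  ∑ i : Fin k, α i * (((i + 1 : ℕ).choose (j + 1) : ℕ) * (h : ℝ) ^ ((i : ℕ) - j))

lemma pow_exp {k : ℕ} (x h : ℝ) (i : Fin k) : (x + h) ^ ((i : ℕ) + 1) = h ^ ((i : ℕ) + 1) +
    ∑ j : Fin k, ((((i : ℕ) + 1).choose ((j : ℕ) + 1) : ℕ) * h ^ ((i : ℕ) - j)) * x ^ ((j : ℕ) + 1) := by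
  rw [add_pow, sum_range_succ']
  simp only [pow_zero, one_mul, Nat.sub_zero, Nat.choose_zero_right, Nat.cast_one, mul_one]
  rw [add_comm]
  congr 1
  rw [Fin.sum_univ_eq_sum_range (fun j => (((((i : ℕ) + 1).choose (j + 1) : ℕ) : ℝ) * h ^ ((i : ℕ) - j)) * x ^ (j + 1)) k]
  rw [← sum_subset (range_subset_range.2 (show (i : ℕ) + 1 ≤ k by omega))]
  · refine sum_congr rfl fun m hm => ?_
    rw [Nat.add_sub_add_right]; ring
  · intro m _ hm
    rw [mem_range] at hm
    rw [Nat.choose_eq_zero_of_lt (by omega)]; simp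

lemma ph_shift {k : ℕ} (α : Fin k → ℝ) (x h : ℕ) :
    ph α (pv k (x + h)) = (∑ i, α i * (h : ℝ) ^ ((i : ℕ) + 1)) + ph (sh h α) (pv k x) := by
  unfold ph pv sh
  push_cast
  simp_rw [pow_exp, mul_add, sum_add_distrib]
  congr 1
  simp_rw [sum_mul, mul_sum]
  rw [sum_comm]
  refine sum_congr rfl fun j _ => sum_congr rfl fun i _ => ?_
  ring

lemma fs_shift {k : ℕ} (P h : ℕ) (α : Fin k → ℝ) : ‖fs P α‖ - 2 * h ≤ ‖fs P (sh h α)‖ := by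
  have h1 := shift_sum (fun x => ee (ph α (pv k x))) (fun x => (ee_norm _).le) P h
  have h2 : ∑ x ∈ Icc 1 P, ee (ph α (pv k (x + h))) = ee (∑ i, α i * (h : ℝ) ^ ((i : ℕ) + 1)) * fs P (sh h α) := by
    unfold fs ES
    rw [mul_sum]
    refine sum_congr rfl fun x _ => ?_
    rw [ph_shift, ee_add]
  rw [h2] at h1
  have h3 := norm_sub_norm_le (∑ x ∈ Icc 1 P, ee (ph α (pv k x))) (ee (∑ i, α i * (h : ℝ) ^ ((i : ℕ) + 1)) * fs P (sh h α))
  rw [norm_sub_rev] at h1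
  rw [norm_mul, ee_norm, one_mul] at h3
  have : ‖fs P α‖ = ‖∑ x ∈ Icc 1 P, ee (ph α (pv k x))‖ := rfl
  linarith

lemma fs_lip {k : ℕ} (P : ℕ) (α β : Fin k → ℝ) :
    ‖fs P α - fs P β‖ ≤ P * (2 * Real.pi * ∑ j, |α j - β j| * (P : ℝ) ^ ((j : ℕ) + 1)) := by
  unfold fs ES
  rw [← sum_sub_distrib]
  have : ∀ x ∈ Icc 1 P, ‖ee (ph α (pv k x)) - ee (ph β (pv k x))‖ ≤ 2 * Real.pi * ∑ j, |α j - β j| * (P : ℝ) ^ ((j : ℕ) + 1) := by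
    intro x hx
    rw [mem_Icc] at hx
    refine (ee_sub_le _ _).trans ?_
    have := Real.pi_pos
    gcongr
    unfold ph pv
    rw [← sum_sub_distrib]
    refine (abs_sum_le_sum_abs _ _).trans ?_
    refine sum_le_sum fun j _ => ?_
    rw [← sub_mul, abs_mul]
    gcongr
    push_cast
    rw [abs_of_nonneg (by positivity)]
    have : (x : ℝ) ≤ P := by exact_mod_cast hx.2
    gcongr
  refine (norm_sum_le _ _).trans ((sum_le_sum this).trans ?_)
  simp

lemma fs_int {k : ℕ} (P : ℕ) (α : Fin k → ℝ) (n : Fin k → ℤ) : fs P (fun j => α j + n j) = fs P α := by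
  unfold fs ES
  refine sum_congr rfl fun x _ => ?_
  have : ph (fun j => α j + n j) (pv k x) = ph α (pv k x) + ((∑ j, n j * pv k x j : ℤ) : ℝ) := by
    unfold ph
    push_cast
    rw [← sum_add_distrib]
    refine sum_congr rfl fun j _ => by ring
  rw [this, ee_add, ee_int, mul_one]

lemma fs_fract {k : ℕ} (P : ℕ) (α : Fin k → ℝ) : fs P (fun j => Int.fract (α j)) = fs P α := by
  rw [← fs_int P _ (fun j => ⌊α j⌋)]
  congr 1; ext j; exact Int.fract_add_floor _

lemma sum_kap (k : ℕ) : ∑ j : Fin k, (((j : ℕ) + 1 : ℕ) : ℝ) = kap k := by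
  induction k with
  | zero => simp [kap]
  | succ k ih =>
    rw [Fin.sum_univ_castSucc]
    simp only [Fin.val_castSucc, Fin.val_last]
    rw [ih]; unfold kap; push_cast; ring

/-- packing bound -/
lemma packing {k : ℕ} (hk : 1 ≤ k) (P s : ℕ) (hP : 1 ≤ P) {τ : Type*} (T : Finset τ) (α : τ → Fin k → ℝ) (Λ ρ : ℝ)
    (hρ : 0 < ρ) (hρ1 : ρ < 1) (hΛ : P * (2 * Real.pi * (k * ρ)) ≤ Λ / 2) (hΛ0 : 0 ≤ Λ)
    (hα : ∀ t ∈ T, Λ ≤ ‖fs P (α t)‖)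
    (hsep : ∀ t ∈ T, ∀ t' ∈ T, t ≠ t' → ∃ j : Fin k, ¬ nz (α t j - α t' j) (2 * ρ / (P : ℝ) ^ ((j : ℕ) + 1))) :
    (T.card : ℝ) * ((2 * ρ) ^ k / (P : ℝ) ^ (kap k)) * (Λ / 2) ^ (2 * s) ≤ 3 ^ k * J k s P := by
  have hP0 : (0 : ℝ) < P := by exact_mod_cast hP
  have hP1 : (1 : ℝ) ≤ P := by exact_mod_cast hP
  set box : τ → Set (Fin k → ℝ) := fun t => Set.pi Set.univ fun j =>
    Set.Icc (Int.fract (α t j) - ρ / (P : ℝ) ^ ((j : ℕ) + 1)) (Int.fract (α t j) + ρ / (P : ℝ) ^ ((j : ℕ) + 1)) with hbox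
  have hr : ∀ j : Fin k, ρ / (P : ℝ) ^ ((j : ℕ) + 1) < 1 := by
    intro j
    rw [div_lt_one (by positivity)]
    exact hρ1.trans_le (one_le_pow₀ hP1)
  have hvol : ∀ t, (volume (box t)).toReal = (2 * ρ) ^ k / (P : ℝ) ^ (kap k) := by
    intro t
    rw [hbox, volume_pi_pi, ENNReal.toReal_prod]
    have : ∀ j : Fin k, (volume (Set.Icc (Int.fract (α t j) - ρ / (P : ℝ) ^ ((j : ℕ) + 1)) (Int.fract (α t j) + ρ / (P : ℝ) ^ ((j : ℕ) + 1)))).toReal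
        = 2 * ρ / (P : ℝ) ^ ((j : ℕ) + 1) := by
      intro j
      rw [Real.volume_Icc, ENNReal.toReal_ofReal (by have : 0 ≤ ρ / (P : ℝ) ^ ((j : ℕ) + 1) := by positivity
                                                     linarith)]
      ring
    simp_rw [this, prod_div_distrib]
    congr 1
    · simp
    · rw [← sum_kap, Real.rpow_sum_of_pos hP0]
      refine prod_congr rfl fun j _ => ?_
      rw [Real.rpow_natCast]
  have hmeas : ∀ t, MeasurableSet (box t) := fun t => MeasurableSet.univ_pi fun j => measurableSet_Icc
  have hdisj : (T : Set τ).PairwiseDisjoint box := by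
    intro t ht t' ht' hne
    rw [Function.onFun, Set.disjoint_left]
    intro x hx hx'
    obtain ⟨j, hj⟩ := hsep t ht t' ht' hne
    apply hj
    have a := hx j (Set.mem_univ _)
    have b := hx' j (Set.mem_univ _)
    simp only [Set.mem_Icc] at a b
    refine ⟨⌊α t j⌋ - ⌊α t' j⌋, ?_⟩
    have e1 := Int.fract_add_floor (α t j)
    have e2 := Int.fract_add_floor (α t' j)
    push_cast
    have e3 : α t j - α t' j - (⌊α t j⌋ - ⌊α t' j⌋ : ℝ) = Int.fract (α t j) - Int.fract (α t' j) := by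
      linarith
    rw [e3, mul_div_assoc, abs_le]
    constructor <;> linarith [a.1, a.2, b.1, b.2]
  set μ := mu k (-1) 3 with hμ
  have hbm : ∀ t, μ (box t) = volume (box t) := by
    intro t
    rw [hμ, mu_eq, Measure.restrict_apply (hmeas t), Set.inter_eq_left.2]
    intro x hx j _
    have a := hx j (Set.mem_univ _)
    simp only [Set.mem_Icc] at a
    have b := hr j
    have c := Int.fract_nonneg (α t j)
    have d := Int.fract_lt_one (α t j)
    simp only [Set.mem_Ioc]
    push_cast
    constructor <;> linarith [a.1, a.2]
  have hsub : (⋃ t ∈ T, box t) ⊆ {x | (Λ / 2) ^ (2 * s) ≤ ‖fs P x‖ ^ (2 * s)} := by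
    intro x hx
    simp only [Set.mem_iUnion] at hx
    obtain ⟨t, ht, hx⟩ := hx
    show (Λ / 2) ^ (2 * s) ≤ ‖fs P x‖ ^ (2 * s)
    gcongr
    have h1 := fs_lip P (fun j => Int.fract (α t j)) x
    rw [fs_fract] at h1
    have h2 : ∑ j : Fin k, |Int.fract (α t j) - x j| * (P : ℝ) ^ ((j : ℕ) + 1) ≤ k * ρ := by
      have : ∀ j ∈ (univ : Finset (Fin k)), |Int.fract (α t j) - x j| * (P : ℝ) ^ ((j : ℕ) + 1) ≤ ρ := by
        intro j _
        have a := hx j (Set.mem_univ _)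
        simp only [Set.mem_Icc] at a
        rw [← le_div_iff₀ (by positivity), abs_le]
        constructor <;> linarith [a.1, a.2]
      refine (sum_le_sum this).trans ?_
      simp
    have h3 : (P : ℝ) * (2 * Real.pi * ∑ j : Fin k, |Int.fract (α t j) - x j| * (P : ℝ) ^ ((j : ℕ) + 1)) ≤ Λ / 2 := by
      refine le_trans ?_ hΛ
      have := Real.pi_pos
      gcongr
    have h4 := norm_sub_norm_le (fs P (α t)) (fs P x)
    linarith [hα t ht]
  have hcont : Continuous fun x : Fin k → ℝ => ‖fs P x‖ ^ (2 * s) := (ES_cont _ _).norm.pow _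
  have key := mul_meas_ge_le_integral_of_nonneg (μ := μ) (f := fun x : Fin k → ℝ => ‖fs P x‖ ^ (2 * s))
    (ae_of_all _ fun x => by positivity) (bdd_integrable _ _ hcont) ((Λ / 2) ^ (2 * s))
  rw [hμ, int_J, ← hμ] at key
  have h5 : (T.card : ℝ) * ((2 * ρ) ^ k / (P : ℝ) ^ (kap k)) ≤ μ.real {x | (Λ / 2) ^ (2 * s) ≤ ‖fs P x‖ ^ (2 * s)} := by
    refine le_trans (le_of_eq ?_) (measureReal_mono hsub)
    rw [measureReal_biUnion_finset hdisj (fun t _ => hmeas t)]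
    have : ∀ t ∈ T, μ.real (box t) = (2 * ρ) ^ k / (P : ℝ) ^ (kap k) := by
      intro t _
      rw [Measure.real, hbm, hvol]
    rw [sum_congr rfl this]; simp
  rw [mul_comm]
  push_cast at key
  refine le_trans ?_ key
  gcongr

end TV

noncomputable section TV

open Finset MeasureTheory

lemma dio (θ ε : ℝ) (N Y : ℕ) (hNY : N ≤ Y) (hε0 : 0 ≤ ε) (hε : (2 * N + 1) * ε < 1) (hY : 1 ≤ Y)
    (h : ∀ y : ℕ, 1 ≤ y → y ≤ Y → ∃ d : ℕ, 1 ≤ d ∧ d ≤ N ∧ nz (d * (y * θ)) ε) :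
    ∃ q : ℕ, 1 ≤ q ∧ q ≤ N ∧ nz (q * θ) (2 * N * ε / Y) := by
  obtain ⟨q, hq1, hqN, a, ha⟩ := h 1 le_rfl hY
  simp only [Nat.cast_one, one_mul] at ha
  have hY0 : (0 : ℝ) < Y := by exact_mod_cast hY
  refine ⟨q, hq1, hqN, a, ?_⟩
  set b := (q : ℝ) * θ - a with hb
  have ind : ∀ m : ℕ, q * m ≤ Y → m * |b| ≤ ε := by
    intro m
    induction m with
    | zero => intro _; simpa using hε0
    | succ m ih =>
      intro hm
      have ih' := ih (le_trans (by nlinarith) hm)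
      obtain ⟨d, hd1, hdN, n, hn⟩ := h (q * (m + 1)) (by nlinarith) hm
      have e1 : (d : ℝ) * (((q * (m + 1) : ℕ) : ℝ) * θ) - n = d * ((m + 1) * b) - ((n - d * (m + 1) * a : ℤ) : ℝ) := by
        rw [hb]; push_cast; ring
      rw [e1] at hn
      have h2 : ((m + 1 : ℕ) : ℝ) * |b| ≤ 2 * ε := by push_cast; linarith
      have hdN' : (d : ℝ) ≤ N := by exact_mod_cast hdN
      have hd1' : (1 : ℝ) ≤ d := by exact_mod_cast hd1
      have h3 : |(d : ℝ) * ((m + 1) * b)| ≤ 2 * N * ε := by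
        rw [abs_mul, abs_mul, abs_of_nonneg (by positivity : (0 : ℝ) ≤ d), abs_of_nonneg (by positivity : (0 : ℝ) ≤ (m : ℝ) + 1)]
        push_cast at h2
        calc (d : ℝ) * (((m : ℝ) + 1) * |b|) ≤ N * (2 * ε) := by gcongr
          _ = _ := by ring
      have h4 : (n - d * (m + 1) * a : ℤ) = 0 := by
        rw [← Int.abs_lt_one_iff]
        have : |((n - d * (m + 1) * a : ℤ) : ℝ)| < 1 := by
          have h5 := abs_sub_abs_le_abs_sub (((n - d * (m + 1) * a : ℤ) : ℝ)) ((d : ℝ) * ((m + 1) * b))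
          rw [abs_sub_comm] at hn
          linarith
        exact_mod_cast this
      rw [h4] at hn
      simp only [Int.cast_zero, sub_zero] at hn
      rw [abs_mul, abs_mul, abs_of_nonneg (by positivity : (0 : ℝ) ≤ d), abs_of_nonneg (by positivity : (0 : ℝ) ≤ (m : ℝ) + 1)] at hn
      push_cast
      have : 0 ≤ ((m : ℝ) + 1) * |b| := by positivity
      nlinarith
  have h6 := ind (Y / q) (Nat.mul_div_le _ _)
  have hq0 : (0 : ℝ) < q := by exact_mod_cast hq1
  have h7 : (Y : ℝ) ≤ 2 * N * (Y / q : ℕ) := by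
    have h8 : 1 ≤ Y / q := (Nat.one_le_div_iff hq1).2 (hqN.trans hNY)
    have h9 : Y < q * (Y / q + 1) := by
      have := Nat.lt_mul_div_succ Y hq1
      linarith
    have h10 : Y ≤ 2 * N * (Y / q) := by
      have : q * (Y / q + 1) ≤ N * (2 * (Y / q)) := Nat.mul_le_mul hqN (by omega)
      nlinarith
    exact_mod_cast h10
  rw [le_div_iff₀ hY0]
  calc |b| * Y ≤ |b| * (2 * N * (Y / q : ℕ)) := by gcongr
    _ = 2 * N * ((Y / q : ℕ) * |b|) := by ring
    _ ≤ 2 * N * ε := by gcongr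

/-- overlap property of shifts -/
def Pk {k : ℕ} (P : ℕ) (α : Fin k → ℝ) (N H : ℕ) : Prop :=
  ∀ h : ℕ → ℕ, (∀ t ≤ N, h t ≤ H) → ∃ t t', t ≤ N ∧ t' ≤ N ∧ t' < t ∧
    ∀ j : Fin k, nz (sh (h t) α j - sh (h t') α j) (1 / (P : ℝ) ^ ((j : ℕ) + 1))

lemma descent {k : ℕ} (P : ℕ) (hP : 1 ≤ P) (α : Fin k → ℝ) (N H : ℕ) (hH : H ≤ P) (hPk : Pk P α N H)
    (j : Fin k) (hj : 1 ≤ (j : ℕ)) (Q : ℕ) (hQ : 1 ≤ Q) (X : ℝ) (hX : 0 ≤ X)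
    (hi : ∀ i : Fin k, j < i → nz (Q * α i) (X / (P : ℝ) ^ ((i : ℕ) + 1)))
    (Y : ℕ) (hY : 1 ≤ Y) (hNY : N ≤ Y) (hYH : Q * Y * N ≤ H)
    (hε : (2 * N + 1) * ((1 + k * 2 ^ k * X) / (P : ℝ) ^ (j : ℕ)) < 1) :
    ∃ q : ℕ, 1 ≤ q ∧ q ≤ N ∧ nz (q * ((((j : ℕ) + 1) * Q : ℕ) * α j)) (2 * N * ((1 + k * 2 ^ k * X) / (P : ℝ) ^ (j : ℕ)) / Y) := by
  have hP0 : (0 : ℝ) < P := by exact_mod_cast hP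
  refine dio _ _ N Y hNY (by positivity) hε hY ?_
  intro y hy1 hyY
  obtain ⟨t, t', ht, ht', hlt, hall⟩ := hPk (fun t => Q * (y * t)) (fun t ht => by
    refine le_trans ?_ hYH
    rw [mul_assoc]
    exact Nat.mul_le_mul_left _ (Nat.mul_le_mul hyY ht))
  refine ⟨t - t', by omega, by omega, ?_⟩
  set jm : Fin k := ⟨j - 1, by omega⟩ with hjm
  have hjj := hall jm
  have hjm1 : (jm : ℕ) + 1 = j := by simp [hjm]; omega
  rw [hjm1] at hjj
  -- tail terms
  set c : Fin k → ℝ := fun i => α i * ((((i : ℕ) + 1).choose j : ℕ) * (((Q * (y * t) : ℕ) : ℝ) ^ ((i : ℕ) - jm) - ((Q * (y * t') : ℕ) : ℝ) ^ ((i : ℕ) - jm))) with hc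
  have hdiff : sh (Q * (y * t)) α jm - sh (Q * (y * t')) α jm = ∑ i, c i := by
    unfold sh
    rw [← sum_sub_distrib]
    refine sum_congr rfl fun i _ => ?_
    rw [hc, hjm1]; ring
  have hub : ∀ s ≤ N, Q * (y * s) ≤ P := by
    intro s hs
    refine le_trans ?_ (hYH.trans hH)
    rw [mul_assoc]
    exact Nat.mul_le_mul_left _ (Nat.mul_le_mul hyY hs)
  have htail : ∀ i ∈ univ.filter (fun i : Fin k => j < i), nz (-c i) (2 ^ k * X / (P : ℝ) ^ (j : ℕ)) := by
    intro i hij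
    rw [mem_filter] at hij
    have hij := hij.2
    have hij' : (j : ℕ) < i := hij
    obtain ⟨m, hm⟩ : ∃ m, (i : ℕ) - jm = m + 1 := ⟨i - j, by have := hjm1; omega⟩
    have hmi : m + 1 + j = (i : ℕ) + 1 := by omega
    set w : ℤ := (((i : ℕ) + 1).choose j : ℕ) * (((Q ^ m * (y * t) ^ (m + 1) : ℕ) : ℤ) - ((Q ^ m * (y * t') ^ (m + 1) : ℕ) : ℤ)) with hw
    have e1 : -c i = ((-w : ℤ) : ℝ) * (Q * α i) := by
      rw [hc, hw]
      simp only [hm]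
      push_cast
      ring
    rw [e1]
    refine ((hi i hij).mul_int (-w)).mono ?_
    have hs : ∀ s ≤ N, ((Q ^ m * (y * s) ^ (m + 1) : ℕ) : ℝ) ≤ (P : ℝ) ^ (m + 1) := by
      intro s hs
      have : Q ^ m * (y * s) ^ (m + 1) ≤ P ^ (m + 1) := by
        calc Q ^ m * (y * s) ^ (m + 1) ≤ Q ^ (m + 1) * (y * s) ^ (m + 1) := by
              gcongr <;> omega
          _ = (Q * (y * s)) ^ (m + 1) := (mul_pow _ _ _).symm
          _ ≤ _ := Nat.pow_le_pow_left (hub s hs) _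
      exact_mod_cast this
    have hw1 : |((-w : ℤ) : ℝ)| ≤ 2 ^ k * (P : ℝ) ^ (m + 1) := by
      rw [hw]
      rw [Int.cast_neg, abs_neg, Int.cast_mul, abs_mul, Int.cast_sub, Int.cast_natCast, Int.cast_natCast, Int.cast_natCast]
      gcongr
      · rw [abs_of_nonneg (by positivity)]
        have h1 : ((i : ℕ) + 1).choose j ≤ 2 ^ ((i : ℕ) + 1) := Nat.choose_le_two_pow _ _
        have h2 : 2 ^ ((i : ℕ) + 1) ≤ 2 ^ k := Nat.pow_le_pow_right (by norm_num) (by omega)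
        exact_mod_cast h1.trans h2
      · have a := hs t ht
        have b := hs t' ht'
        have a0 : (0 : ℝ) ≤ ((Q ^ m * (y * t) ^ (m + 1) : ℕ) : ℝ) := by positivity
        have b0 : (0 : ℝ) ≤ ((Q ^ m * (y * t') ^ (m + 1) : ℕ) : ℝ) := by positivity
        rw [abs_le]; constructor <;> linarith
    calc |((-w : ℤ) : ℝ)| * (X / (P : ℝ) ^ ((i : ℕ) + 1)) ≤ 2 ^ k * (P : ℝ) ^ (m + 1) * (X / (P : ℝ) ^ ((i : ℕ) + 1)) := by gcongr
      _ = 2 ^ k * X / (P : ℝ) ^ (j : ℕ) := by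
        rw [← hmi, pow_add _ (m + 1)]
        field_simp
  have hnz := hjj.add (nz_sum _ _ _ htail)
  have e2 : sh (Q * (y * t)) α jm - sh (Q * (y * t')) α jm + ∑ i ∈ univ.filter (fun i : Fin k => j < i), -c i = c j := by
    rw [hdiff, sum_neg_distrib, ← sum_filter_add_sum_filter_not univ (fun i : Fin k => j < i), add_neg_cancel_comm]
    rw [sum_eq_single j]
    · intro i hi hne
      rw [mem_filter] at hi
      have : i < j := lt_of_le_of_ne (not_lt.1 hi.2) hne
      have this' : (i : ℕ) < j := this
      have h0 : (i : ℕ) - jm = 0 := by omega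
      simp only [hc, h0, pow_zero, sub_self, mul_zero]
    · intro h; simp at h
  rw [e2] at hnz
  have e3 : c j = ((t - t' : ℕ) : ℝ) * (y * (((((j : ℕ) + 1) * Q : ℕ) : ℝ) * α j)) := by
    have h1 : (j : ℕ) - jm = 1 := by omega
    simp only [hc, h1, pow_one, Nat.choose_succ_self_right]
    push_cast [Nat.cast_sub hlt.le]
    ring
  rw [← e3]
  refine hnz.mono ?_
  rw [sum_const, nsmul_eq_mul]
  have hcard : (((univ.filter (fun i : Fin k => j < i)).card : ℕ) : ℝ) ≤ k := by
    have := card_filter_le (univ : Finset (Fin k)) (fun i : Fin k => j < i)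
    rw [card_univ, Fintype.card_fin] at this
    exact_mod_cast this
  calc 1 / (P : ℝ) ^ (j : ℕ) + (((univ.filter (fun i : Fin k => j < i)).card : ℕ) : ℝ) * (2 ^ k * X / (P : ℝ) ^ (j : ℕ))
      ≤ 1 / (P : ℝ) ^ (j : ℕ) + k * (2 ^ k * X / (P : ℝ) ^ (j : ℕ)) := by gcongr
    _ = _ := by ring

lemma ee_dist (x e : ℝ) (h : ‖1 - ee x‖ ≤ e) : nz x e := by
  refine ⟨round x, ?_⟩
  set y := x - round x with hy
  have h1 : ee x = ee y := by
    have : x = y + (round x : ℤ) := by rw [hy]; ring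
    conv_lhs => rw [this]
    rw [ee_add, ee_int, mul_one]
  have h2 : |y| ≤ 1 / 2 := abs_sub_round x
  rw [h1] at h
  refine le_trans ?_ h
  have h3 : ‖1 - ee y‖ = 2 * |Real.sin (Real.pi * y)| := by
    rw [norm_sub_rev]
    unfold ee
    rw [mul_comm, Complex.norm_exp_I_mul_ofReal_sub_one]
    rw [Real.norm_eq_abs, abs_mul, abs_two]
    congr 3; ring
  rw [h3]
  have hpi := Real.pi_pos
  have h4 := Real.mul_abs_le_abs_sin (x := Real.pi * y) (by
    rw [abs_mul, abs_of_pos hpi]; nlinarith)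
  rw [abs_mul, abs_of_pos hpi] at h4
  have h5 : 2 / Real.pi * (Real.pi * |y|) = 2 * |y| := by field_simp
  rw [h5] at h4
  have := abs_nonneg y
  linarith

end TV

noncomputable section TV

open Finset MeasureTheory

set_option maxHeartbeats 1000000 in
lemma descent_all {k : ℕ} (hk : 2 ≤ k) (P : ℕ) (hP : 1 ≤ P) (α : Fin k → ℝ) (N H : ℕ) (hH : H ≤ P)
    (hPk : Pk P α N H) (B : ℝ) (hB : 5 + k * 2 ^ k ≤ B) (hN1 : 1 ≤ N) (hN : (N : ℝ) ≤ B) (hHB : (P : ℝ) ≤ B * H)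
    (hBP : B ^ ((2 * k + 6) * (k + 2)) ≤ P) (n : ℕ) (hn : n + 1 ≤ k) :
    ∃ Q : ℕ, 1 ≤ Q ∧ (Q : ℝ) ≤ B ^ (2 * n) ∧ ∀ i : Fin k, k ≤ i + n →
      nz (Q * α i) (B ^ ((2 * k + 6) * n) / (P : ℝ) ^ ((i : ℕ) + 1)) := by
  have hk0 : (0 : ℝ) ≤ k * 2 ^ k := by positivity
  have hB5 : 5 ≤ B := by linarith
  have hB1 : 1 ≤ B := by linarith
  have hB0 : 0 < B := by linarith
  have hkB : (k : ℝ) ≤ B := by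
    have : (1 : ℝ) ≤ 2 ^ k := one_le_pow₀ (by norm_num)
    nlinarith [show (0 : ℝ) ≤ k from by positivity]
  have hP0 : (0 : ℝ) < P := by exact_mod_cast hP
  have hP1 : (1 : ℝ) ≤ P := by exact_mod_cast hP
  have hN0 : (0 : ℝ) < N := by exact_mod_cast hN1
  have pw : ∀ {a b : ℕ}, a ≤ b → B ^ a ≤ B ^ b := fun h => pow_le_pow_right₀ hB1 h
  induction n with
  | zero =>
    refine ⟨1, le_rfl, by simp, ?_⟩
    intro i hi; have := i.2; omega
  | succ n ih =>
    obtain ⟨Q, hQ1, hQB, hQ⟩ := ih (by omega)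
    set X : ℝ := B ^ ((2 * k + 6) * n) with hX
    have hX1 : 1 ≤ X := one_le_pow₀ hB1
    have hQ0 : (0 : ℝ) < Q := by exact_mod_cast hQ1
    set j : Fin k := ⟨k - 1 - n, by omega⟩ with hj
    have hjv : (j : ℕ) = k - 1 - n := rfl
    have hH0 : (0 : ℝ) < H := by
      by_contra h
      have : B * H ≤ 0 := mul_nonpos_of_nonneg_of_nonpos hB0.le (not_lt.1 h)
      linarith
    have e1 : Q * N * N ≤ H := by
      have : (Q : ℝ) * N * N * B ≤ H * B := by
        calc (Q : ℝ) * N * N * B ≤ B ^ (2 * n) * B * B * B := by gcongr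
          _ = B ^ (2 * n + 3) := by ring
          _ ≤ B ^ ((2 * k + 6) * (k + 2)) := pw (by nlinarith)
          _ ≤ P := hBP
          _ ≤ _ := by linarith
      have := le_of_mul_le_mul_right this hB0
      exact_mod_cast this
    have hQN : 0 < Q * N := by positivity
    set Y := H / (Q * N) with hY
    have hNY : N ≤ Y := by
      rw [hY, Nat.le_div_iff_mul_le hQN]; linarith
    have hY1 : 1 ≤ Y := hN1.trans hNY
    have hYH : Q * Y * N ≤ H := by
      have := Nat.div_mul_le_self H (Q * N)
      rw [← hY] at this
      linarith
    have hY0 : (0 : ℝ) < Y := by exact_mod_cast hY1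
    have hYP : (P : ℝ) ≤ 2 * B ^ (2 * n + 2) * Y := by
      have h1 : H < Q * N * (Y + 1) := Nat.lt_mul_div_succ H hQN
      have h2 : H ≤ 2 * (Q * N * Y) := by nlinarith
      have h3 : (H : ℝ) ≤ 2 * (Q * N * Y) := by exact_mod_cast h2
      calc (P : ℝ) ≤ B * H := hHB
        _ ≤ B * (2 * (Q * N * Y)) := by gcongr
        _ ≤ B * (2 * (B ^ (2 * n) * B * Y)) := by gcongr
        _ = _ := by ring
    have hcX : 1 + k * 2 ^ k * X ≤ B * X := by nlinarith
    have hPj : (P : ℝ) ≤ (P : ℝ) ^ (j : ℕ) := by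
      calc (P : ℝ) = (P : ℝ) ^ 1 := (pow_one _).symm
        _ ≤ _ := pow_le_pow_right₀ hP1 (by omega)
    have hε : (2 * (N : ℝ) + 1) * ((1 + k * 2 ^ k * X) / (P : ℝ) ^ (j : ℕ)) < 1 := by
      rw [← mul_div_assoc, div_lt_one (by positivity)]
      refine lt_of_lt_of_le ?_ hPj
      refine lt_of_lt_of_le ?_ hBP
      calc (2 * (N : ℝ) + 1) * (1 + k * 2 ^ k * X) ≤ (3 * B) * (B * X) := by
            gcongr
            linarith
        _ < B * B * (B * X) := by
            have : 0 < B * X := by positivity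
            exact mul_lt_mul_of_pos_right (by nlinarith) this
        _ = B ^ ((2 * k + 6) * n + 3) := by rw [hX]; ring
        _ ≤ _ := pw (by nlinarith)
    obtain ⟨q, hq1, hqN, hq⟩ := descent P hP α N H hH hPk j (by omega) Q hQ1 X (by positivity)
      (fun i hi => hQ i (by have : (j : ℕ) < i := hi; omega)) Y hY1 hNY hYH hε
    have hqB : (q : ℝ) ≤ B := le_trans (by exact_mod_cast hqN) hN
    have hjk : ((j : ℕ) : ℝ) + 1 ≤ k := by exact_mod_cast (by omega : (j : ℕ) + 1 ≤ k)
    refine ⟨q * (((j : ℕ) + 1) * Q), ?_, ?_, ?_⟩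
    · exact Nat.one_le_iff_ne_zero.2 (by positivity)
    · push_cast
      calc (q : ℝ) * ((((j : ℕ) : ℝ) + 1) * Q) ≤ B * (B * B ^ (2 * n)) := by
            gcongr
            exact hjk.trans hkB
        _ = _ := by ring
    · intro i hi
      by_cases hij : i = j
      · subst hij
        push_cast at hq ⊢
        rw [mul_assoc]
        refine hq.mono ?_
        rw [div_le_div_iff₀ hY0 (by positivity)]
        have hPj0 : (0 : ℝ) < (P : ℝ) ^ (j : ℕ) := by positivity
        calc 2 * (N : ℝ) * ((1 + k * 2 ^ k * X) / (P : ℝ) ^ (j : ℕ)) * (P : ℝ) ^ ((j : ℕ) + 1)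
            = 2 * N * (1 + k * 2 ^ k * X) * P := by rw [pow_succ]; field_simp
          _ ≤ 2 * B * (B * X) * (2 * B ^ (2 * n + 2) * Y) := by gcongr
          _ = 4 * (B ^ ((2 * k + 6) * n + (2 * n + 4)) * Y) := by rw [hX]; ring
          _ ≤ B * (B ^ ((2 * k + 6) * n + (2 * n + 4)) * Y) := by gcongr; linarith
          _ = B ^ ((2 * k + 6) * n + (2 * n + 5)) * Y := by ring
          _ ≤ B ^ ((2 * k + 6) * (n + 1)) * Y := by
            gcongr ?_ * _
            exact pw (by nlinarith)
      · have h1 : k ≤ i + n := by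
          have : (i : ℕ) ≠ j := fun h => hij (Fin.ext h)
          omega
        have h2 := (hQ i h1).mul_int ((q * ((j : ℕ) + 1) : ℕ) : ℤ)
        have e2 : ((q * (((j : ℕ) + 1) * Q) : ℕ) : ℝ) * α i = (((q * ((j : ℕ) + 1) : ℕ) : ℤ) : ℝ) * (Q * α i) := by
          push_cast; ring
        rw [e2]
        refine h2.mono ?_
        rw [Int.cast_natCast, abs_of_nonneg (by positivity), ← mul_div_assoc]
        gcongr
        push_cast
        calc (q : ℝ) * (((j : ℕ) : ℝ) + 1) * X ≤ B * B * X := by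
              gcongr
              exact hjk.trans hkB
          _ = B ^ ((2 * k + 6) * n + 2) := by rw [hX]; ring
          _ ≤ B ^ ((2 * k + 6) * (n + 1)) := pw (by rw [Nat.mul_succ]; omega)

lemma ee_nz {u e : ℝ} (h : nz u e) : ‖ee u - 1‖ ≤ 2 * Real.pi * e := by
  obtain ⟨n, hn⟩ := h
  rw [← ee_int n]
  refine (ee_sub_le _ _).trans ?_
  have := Real.pi_pos
  gcongr

lemma alpha_one {k : ℕ} (hk : 1 ≤ k) (P : ℕ) (hP : 1 ≤ P) (α : Fin k → ℝ) (Q : ℕ) (hQP : Q ≤ P)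
    (X : ℝ) (hX : 0 ≤ X) (hQ : ∀ i : Fin k, 1 ≤ (i : ℕ) → nz (Q * α i) (X / (P : ℝ) ^ ((i : ℕ) + 1)))
    (Λ : ℝ) (hΛ : 0 < Λ) (hf : Λ ≤ ‖fs P α‖) :
    nz (Q * α ⟨0, hk⟩) ((2 * Q + 2 * Real.pi * (k * (k * 2 ^ k * X))) / Λ) := by
  have hP0 : (0 : ℝ) < P := by exact_mod_cast hP
  have hpi := Real.pi_pos
  set i0 : Fin k := ⟨0, hk⟩ with hi0
  set F : ℕ → ℂ := fun x => ee (ph α (pv k x)) with hF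
  set z := ee (Q * α i0) with hz
  have hstep : ∀ x ∈ Icc 1 P, ‖F (x + Q) - z * F x‖ ≤ 2 * Real.pi * (k * (k * 2 ^ k * X)) / P := by
    intro x hx
    rw [mem_Icc] at hx
    set c : Fin k → ℝ := fun i => α i * (((x + Q : ℕ) : ℝ) ^ ((i : ℕ) + 1) - (x : ℝ) ^ ((i : ℕ) + 1)) with hc
    have hd : ph α (pv k (x + Q)) = Q * α i0 + (∑ i ∈ univ.erase i0, c i + ph α (pv k x)) := by
      have : ph α (pv k (x + Q)) = ∑ i, c i + ph α (pv k x) := by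
        unfold ph pv
        rw [← sum_add_distrib]
        refine sum_congr rfl fun i _ => ?_
        rw [hc]; push_cast; ring
      rw [this, ← add_sum_erase _ _ (mem_univ i0)]
      have : c i0 = Q * α i0 := by
        simp only [hc, hi0]; push_cast; ring
      rw [this]; ring
    have hnz : nz (∑ i ∈ univ.erase i0, c i) (∑ i ∈ univ.erase i0, (k * 2 ^ k * X / P)) := by
      refine nz_sum _ _ _ fun i hi => ?_
      have hi1 : 1 ≤ (i : ℕ) := by
        have : i ≠ i0 := ne_of_mem_erase hi
        rw [Nat.one_le_iff_ne_zero]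
        intro h
        exact this (Fin.ext h)
      set w : ℕ := ∑ m ∈ range ((i : ℕ) + 1), (x + Q) ^ m * x ^ ((i : ℕ) + 1 - 1 - m) with hw
      have e1 : c i = ((w : ℤ) : ℝ) * (Q * α i) := by
        have := Commute.geom_sum₂_mul (Commute.all ((x + Q : ℕ) : ℝ) (x : ℝ)) ((i : ℕ) + 1)
        simp only [hc]
        rw [← this, hw]
        push_cast
        ring
      rw [e1]
      refine ((hQ i hi1).mul_int w).mono ?_
      rw [Int.cast_natCast, abs_of_nonneg (by positivity)]
      have hwb : (w : ℝ) ≤ k * (2 ^ k * (P : ℝ) ^ (i : ℕ)) := by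
        have : w ≤ ∑ m ∈ range ((i : ℕ) + 1), (2 * P) ^ (i : ℕ) := by
          refine sum_le_sum fun m hm => ?_
          rw [mem_range] at hm
          calc (x + Q) ^ m * x ^ ((i : ℕ) + 1 - 1 - m) ≤ (2 * P) ^ m * (2 * P) ^ ((i : ℕ) + 1 - 1 - m) := by
                gcongr <;> omega
            _ = (2 * P) ^ (i : ℕ) := by rw [← pow_add]; congr 1; omega
        rw [sum_const, card_range, smul_eq_mul, mul_pow] at this
        have h2 : ((i : ℕ) + 1) * (2 ^ (i : ℕ) * P ^ (i : ℕ)) ≤ k * (2 ^ k * P ^ (i : ℕ)) := by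
          gcongr
          · omega
          · norm_num
          · exact i.2.le
        exact_mod_cast this.trans h2
      calc (w : ℝ) * (X / (P : ℝ) ^ ((i : ℕ) + 1)) ≤ k * (2 ^ k * (P : ℝ) ^ (i : ℕ)) * (X / (P : ℝ) ^ ((i : ℕ) + 1)) := by gcongr
        _ = k * 2 ^ k * X / P := by rw [pow_succ]; field_simp
    have e3 : F (x + Q) - z * F x = z * F x * (ee (∑ i ∈ univ.erase i0, c i) - 1) := by
      simp only [hF]
      rw [hd, ee_add, ee_add]; ring
    rw [e3, norm_mul, norm_mul, hz, ee_norm, hF]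
    simp only [ee_norm, one_mul]
    refine (ee_nz hnz).trans ?_
    rw [sum_const, nsmul_eq_mul]
    have := card_erase_le (s := (univ : Finset (Fin k))) (a := i0)
    rw [card_univ, Fintype.card_fin] at this
    have this' : (((univ : Finset (Fin k)).erase i0).card : ℝ) ≤ k := by exact_mod_cast this
    calc 2 * Real.pi * ((((univ : Finset (Fin k)).erase i0).card : ℝ) * (k * 2 ^ k * X / P)) ≤
          2 * Real.pi * (k * (k * 2 ^ k * X / P)) := by gcongr
      _ = _ := by ring
  set S := ∑ x ∈ Icc 1 P, F x with hS
  have h1 : ‖∑ x ∈ Icc 1 P, F (x + Q) - z * S‖ ≤ 2 * Real.pi * (k * (k * 2 ^ k * X)) := by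
    rw [hS, mul_sum, ← sum_sub_distrib]
    refine (norm_sum_le _ _).trans ((sum_le_sum hstep).trans ?_)
    rw [sum_const, nsmul_eq_mul, Nat.card_Icc, Nat.add_sub_cancel]
    rw [mul_div_cancel₀ _ hP0.ne']
  have h2 := shift_sum F (fun x => (ee_norm _).le) P Q
  have h3 : ‖1 - z‖ * ‖S‖ ≤ 2 * Q + 2 * Real.pi * (k * (k * 2 ^ k * X)) := by
    rw [← norm_mul]
    have : (1 - z) * S = (∑ x ∈ Icc 1 P, F (x + Q) - z * S) - (∑ x ∈ Icc 1 P, F (x + Q) - S) := by ring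
    rw [this]
    refine (norm_sub_le _ _).trans ?_
    linarith
  apply ee_dist
  rw [le_div_iff₀ hΛ]
  refine le_trans ?_ h3
  gcongr
  exact hf

end TV

noncomputable section TV

open Finset MeasureTheory

lemma Pk_of_large {k : ℕ} (hk : 1 ≤ k) (P s : ℕ) (hP : 1 ≤ P) (α : Fin k → ℝ) (N H : ℕ) (lam C η : ℝ)
    (hl0 : 0 < lam) (hl1 : lam ≤ 1) (hf : lam * P ≤ ‖fs P α‖) (hH : (H : ℝ) ≤ lam * P / 4)
    (hJ : (J k s P : ℝ) ≤ C * (P : ℝ) ^ (2 * (s : ℝ) - kap k + η))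
    (hbig : 3 ^ k * C * (P : ℝ) ^ η < (N + 1) * ((lam / (4 * Real.pi * k)) ^ k * (lam / 4) ^ (2 * s))) :
    Pk P α N H := by
  have hP0 : (0 : ℝ) < P := by exact_mod_cast hP
  have hpi := Real.pi_gt_three
  have hk' : (1 : ℝ) ≤ k := by exact_mod_cast hk
  have hk0 : (0 : ℝ) < k := by linarith
  by_contra hcon
  unfold Pk at hcon
  push Not at hcon
  obtain ⟨h, hh, hsep⟩ := hcon
  have hpk : 12 ≤ 4 * Real.pi * k := by nlinarith
  have hr1 : lam / (4 * Real.pi * k) ≤ 1 := by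
    rw [div_le_one (by linarith)]; linarith
  have e2ρ : 2 * (lam / (8 * Real.pi * k)) = lam / (4 * Real.pi * k) := by field_simp; norm_num
  have hnot : ∀ t t', t ≤ N → t' ≤ N → t' < t → ∃ j : Fin k, ¬ nz (sh (h t) α j - sh (h t') α j)
      (2 * (lam / (8 * Real.pi * k)) / (P : ℝ) ^ ((j : ℕ) + 1)) := by
    intro t t' ht ht' hlt
    obtain ⟨j, hj⟩ := hsep t t' ht ht' hlt
    refine ⟨j, fun hc => hj (hc.mono ?_)⟩
    rw [e2ρ]
    gcongr
  have key := packing hk P s hP (range (N + 1)) (fun t => sh (h t) α) (lam * P / 2) (lam / (8 * Real.pi * k))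
    (by positivity) (by
      rw [div_lt_one (by positivity)]; nlinarith) (by
      refine le_of_eq ?_
      field_simp; norm_num) (by positivity) ?_ ?_
  · rw [card_range, e2ρ] at key
    have h1 := key.trans (mul_le_mul_of_nonneg_left hJ (by positivity : (0 : ℝ) ≤ 3 ^ k))
    have hκ : (0 : ℝ) < (P : ℝ) ^ kap k := Real.rpow_pos_of_pos hP0 _
    have e3 : (P : ℝ) ^ (2 * (s : ℝ) - kap k + η) = (P : ℝ) ^ (2 * s) * (P : ℝ) ^ η / (P : ℝ) ^ kap k := by
      rw [← Real.rpow_natCast, ← Real.rpow_add hP0, ← Real.rpow_sub hP0]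
      congr 1; push_cast; ring
    have e4 : ((N + 1 : ℕ) : ℝ) * ((lam / (4 * Real.pi * k)) ^ k / (P : ℝ) ^ kap k) * (lam * P / 2 / 2) ^ (2 * s) =
      ((N + 1) * ((lam / (4 * Real.pi * k)) ^ k * (lam / 4) ^ (2 * s))) * ((P : ℝ) ^ (2 * s) / (P : ℝ) ^ kap k) := by
      rw [show lam * P / 2 / 2 = (lam / 4) * P by ring, mul_pow]
      push_cast; ring
    have e5 : 3 ^ k * (C * (P : ℝ) ^ (2 * (s : ℝ) - kap k + η)) = (3 ^ k * C * (P : ℝ) ^ η) * ((P : ℝ) ^ (2 * s) / (P : ℝ) ^ kap k) := by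
      rw [e3]; ring
    rw [e4, e5] at h1
    have := le_of_mul_le_mul_right h1 (by positivity)
    linarith
  · intro t ht
    rw [mem_range] at ht
    have h1 := fs_shift P (h t) α
    have h2 : (h t : ℝ) ≤ lam * P / 4 := le_trans (by exact_mod_cast hh t (by omega)) hH
    linarith
  · intro t ht t' ht' hne
    rw [mem_range] at ht ht'
    rcases lt_or_gt_of_ne hne with hlt | hlt
    · obtain ⟨j, hj⟩ := hnot t' t (by omega) (by omega) hlt
      refine ⟨j, fun hc => hj ?_⟩
      have := hc.neg
      rwa [neg_sub] at this
    · exact hnot t t' (by omega) (by omega) hlt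

lemma struct_det {k : ℕ} (hk : 2 ≤ k) (P s : ℕ) (hP : 1 ≤ P) (α : Fin k → ℝ) (B lam C η : ℝ)
    (hl0 : 0 < lam) (hl1 : lam ≤ 1) (hf : lam * P ≤ ‖fs P α‖)
    (hJ : (J k s P : ℝ) ≤ C * (P : ℝ) ^ (2 * (s : ℝ) - kap k + η))
    (hbig : 3 ^ k * C * (P : ℝ) ^ η < B * ((lam / (4 * Real.pi * k)) ^ k * (lam / 4) ^ (2 * s)))
    (hlP : 8 ≤ lam * P) (hlB : 8 ≤ B * lam) (hB : 5 + k * 2 ^ k ≤ B) (hBP : B ^ ((2 * k + 6) * (k + 2)) ≤ P) :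
    ∃ Q : ℕ, 1 ≤ Q ∧ (Q : ℝ) ≤ B ^ ((2 * k + 6) * (k + 2)) ∧ ∀ i : Fin k,
      nz (Q * α i) (B ^ ((2 * k + 6) * (k + 2)) / (P : ℝ) ^ ((i : ℕ) + 1)) := by
  have hP0 : (0 : ℝ) < P := by exact_mod_cast hP
  have hk0 : (0 : ℝ) ≤ k * 2 ^ k := by positivity
  have hB5 : 5 ≤ B := by linarith
  have hB1 : 1 ≤ B := by linarith
  have hB0 : 0 < B := by linarith
  have hkB : (k : ℝ) ≤ B := by
    have : (1 : ℝ) ≤ 2 ^ k := one_le_pow₀ (by norm_num)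
    nlinarith [show (0 : ℝ) ≤ k from by positivity]
  have pw : ∀ {a b : ℕ}, a ≤ b → B ^ a ≤ B ^ b := fun h => pow_le_pow_right₀ hB1 h
  have hpi := Real.pi_pos
  set N := ⌊B⌋₊ with hN
  set H := ⌊lam * P / 4⌋₊ with hH
  have hN1 : B < N + 1 := Nat.lt_floor_add_one B
  have hNB : (N : ℝ) ≤ B := Nat.floor_le hB0.le
  have hH1 : lam * P / 4 < H + 1 := Nat.lt_floor_add_one _
  have hHB : (H : ℝ) ≤ lam * P / 4 := Nat.floor_le (by positivity)
  have hHP : H ≤ P := by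
    have : (H : ℝ) ≤ P := by nlinarith
    exact_mod_cast this
  have hPk : Pk P α N H := by
    refine Pk_of_large (by omega) P s hP α N H lam C η hl0 hl1 hf hHB hJ (hbig.trans_le ?_)
    gcongr
  obtain ⟨Q, hQ1, hQB, hQ⟩ := descent_all hk P hP α N H hHP hPk B hB (by
      rw [hN, Nat.one_le_floor_iff]; exact hB1) hNB (by
      have : lam * P / 8 ≤ H := by linarith
      calc (P : ℝ) = 8 * (P / 8) := by ring
        _ ≤ B * lam * (P / 8) := by gcongr
        _ = B * (lam * P / 8) := by ring
        _ ≤ B * H := by gcongr) hBP (k - 1) (by omega)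
  set X : ℝ := B ^ ((2 * k + 6) * (k - 1)) with hX
  have hXM : X ≤ B ^ ((2 * k + 6) * (k + 2)) := pw (Nat.mul_le_mul_left _ (by omega))
  have hQX : (Q : ℝ) ≤ X := hQB.trans (pw (Nat.mul_le_mul_right _ (by omega)))
  have hQM := hQX.trans hXM
  have hX0 : 0 < X := by positivity
  refine ⟨Q, hQ1, hQM, ?_⟩
  intro i
  by_cases hi : 1 ≤ (i : ℕ)
  · refine (hQ i (by omega)).mono ?_
    gcongr
  · have hi0 : i = ⟨0, by omega⟩ := Fin.ext (by simp; omega)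
    rw [hi0]
    have := alpha_one (by omega : 1 ≤ k) P hP α Q (by exact_mod_cast hQM.trans hBP) X hX0.le
      (fun i hi => hQ i (by omega)) (lam * P) (by positivity) hf
    refine this.mono ?_
    simp only [zero_add, pow_one]
    rw [div_le_div_iff₀ (by positivity) hP0]
    have h7 : 2 * Real.pi ≤ 7 := by have := Real.pi_lt_d2; linarith
    have e1 : 2 * (Q : ℝ) + 2 * Real.pi * (k * (k * 2 ^ k * X)) ≤ 8 * (B ^ 2 * X) := by
      have : 2 * Real.pi * (k * (k * 2 ^ k * X)) ≤ 7 * (B * (B * X)) := by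
        gcongr
        linarith
      have h2 : (2 : ℝ) * X ≤ B ^ 2 * X := by
        gcongr; nlinarith
      nlinarith
    calc (2 * (Q : ℝ) + 2 * Real.pi * (k * (k * 2 ^ k * X))) * P ≤ 8 * (B ^ 2 * X) * P := by gcongr
      _ ≤ (B * lam) * (B ^ 2 * X) * P := by gcongr
      _ = B ^ ((2 * k + 6) * (k - 1) + 3) * (lam * P) := by rw [hX]; ring
      _ ≤ _ := by
        gcongr ?_ * _
        apply pw
        calc (2 * k + 6) * (k - 1) + 3 ≤ (2 * k + 6) * (k - 1 + 1) := by rw [Nat.mul_succ]; omega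
          _ ≤ _ := Nat.mul_le_mul_left _ (by omega)

lemma ev_rpow (a : ℝ) (ha : 0 < a) (K : ℝ) : ∀ᶠ P : ℕ in Filter.atTop, K ≤ (P : ℝ) ^ a :=
  ((tendsto_rpow_atTop ha).comp tendsto_natCast_atTop_atTop).eventually_ge_atTop K

lemma struct_thm {k : ℕ} (hk : 2 ≤ k) (s : ℕ) (C η ε δ σ : ℝ) (hC : 0 < C) (hδ : 0 < δ) (hδ1 : δ < 1) (hε : 0 < ε)
    (hδε : δ < ε) (hpar : η + δ * (k + 2 * s) < ε) (hσ : ε * ((2 * k + 6) * (k + 2)) ≤ σ) (hσ1 : σ ≤ 1)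
    (hJ : ∀ P : ℕ, 1 ≤ P → (J k s P : ℝ) ≤ C * (P : ℝ) ^ (2 * (s : ℝ) - kap k + η)) :
    ∀ᶠ P : ℕ in Filter.atTop, ∀ α : Fin k → ℝ, (P : ℝ) ^ (1 - δ) ≤ ‖fs P α‖ →
      ∃ Q : ℕ, 1 ≤ Q ∧ (Q : ℝ) ≤ (P : ℝ) ^ σ ∧ ∀ i : Fin k,
      nz (Q * α i) ((P : ℝ) ^ σ / (P : ℝ) ^ ((i : ℕ) + 1)) := by
  have hk0 : (0 : ℝ) < k := by exact_mod_cast (by omega : 0 < k)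
  have hpi := Real.pi_pos
  set c : ℝ := (1 / (4 * Real.pi * k)) ^ k * (1 / 4) ^ (2 * s) with hc
  have hc0 : 0 < c := by positivity
  filter_upwards [ev_rpow (1 - δ) (by linarith) 8, ev_rpow (ε - δ) (by linarith) 8, ev_rpow ε hε (5 + k * 2 ^ k),
    ev_rpow (ε - η - δ * (k + 2 * s)) (by linarith) ((3 ^ k * C + 1) / c), Filter.eventually_ge_atTop 1] with P h1 h2 h3 h4 hP α hα
  have hP0 : (0 : ℝ) < P := by exact_mod_cast hP
  have hP1 : (1 : ℝ) ≤ P := by exact_mod_cast hP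
  have e1 : (P : ℝ) ^ (-δ) * P = (P : ℝ) ^ (1 - δ) := by
    rw [sub_eq_add_neg, add_comm, Real.rpow_add hP0, Real.rpow_one]
  have e2 : (P : ℝ) ^ ε * (P : ℝ) ^ (-δ) = (P : ℝ) ^ (ε - δ) := by
    rw [← Real.rpow_add hP0, sub_eq_add_neg]
  have e3 : ((P : ℝ) ^ ε) ^ ((2 * k + 6) * (k + 2)) = (P : ℝ) ^ (ε * ((2 * k + 6) * (k + 2))) := by
    rw [← Real.rpow_natCast, ← Real.rpow_mul hP0.le]; push_cast; rfl
  have e4 : ((P : ℝ) ^ ε) ^ ((2 * k + 6) * (k + 2)) ≤ (P : ℝ) ^ σ := by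
    rw [e3]; exact Real.rpow_le_rpow_of_exponent_le hP1 hσ
  have e5 : (P : ℝ) ^ σ ≤ P := by
    calc (P : ℝ) ^ σ ≤ (P : ℝ) ^ (1 : ℝ) := Real.rpow_le_rpow_of_exponent_le hP1 hσ1
      _ = P := Real.rpow_one _
  have hbig : 3 ^ k * C * (P : ℝ) ^ η < (P : ℝ) ^ ε * (((P : ℝ) ^ (-δ) / (4 * Real.pi * k)) ^ k * ((P : ℝ) ^ (-δ) / 4) ^ (2 * s)) := by
    rw [div_le_iff₀ hc0] at h4
    have e6 : (P : ℝ) ^ ε * (((P : ℝ) ^ (-δ) / (4 * Real.pi * k)) ^ k * ((P : ℝ) ^ (-δ) / 4) ^ (2 * s)) =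
        (P : ℝ) ^ (ε - η - δ * (k + 2 * s)) * c * (P : ℝ) ^ η := by
      have : (P : ℝ) ^ ε * (((P : ℝ) ^ (-δ)) ^ k * ((P : ℝ) ^ (-δ)) ^ (2 * s)) = (P : ℝ) ^ (ε - η - δ * (k + 2 * s)) * (P : ℝ) ^ η := by
        rw [← Real.rpow_natCast, ← Real.rpow_natCast, ← Real.rpow_mul hP0.le, ← Real.rpow_mul hP0.le,
          ← Real.rpow_add hP0, ← Real.rpow_add hP0, ← Real.rpow_add hP0]
        congr 1; push_cast; ring
      have e7 : (P : ℝ) ^ (ε - η - δ * (k + 2 * s)) * c * (P : ℝ) ^ η = (P : ℝ) ^ (ε - η - δ * (k + 2 * s)) * (P : ℝ) ^ η * c := by ring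
      rw [e7, ← this, hc, div_pow, div_pow, div_pow, div_pow]
      ring
    rw [e6]
    have : (0 : ℝ) < (P : ℝ) ^ η := Real.rpow_pos_of_pos hP0 _
    exact mul_lt_mul_of_pos_right (by linarith) this
  obtain ⟨Q, hQ1, hQ2, hQ3⟩ := struct_det hk P s hP α ((P : ℝ) ^ ε) ((P : ℝ) ^ (-δ)) C η (by positivity)
    (Real.rpow_le_one_of_one_le_of_nonpos hP1 (by linarith)) (by rw [e1]; exact hα) (hJ P hP) hbig
    (by rw [e1]; exact h1) (by rw [e2]; exact h2) h3 (e4.trans e5)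
  refine ⟨Q, hQ1, hQ2.trans e4, fun i => (hQ3 i).mono ?_⟩
  gcongr

end TV

noncomputable section TV

open Finset MeasureTheory

lemma per_sum (F g : ℕ → ℂ) (q : ℕ) (hq : 1 ≤ q) (N : ℕ) (L : ℝ) (hL : 0 ≤ L)
    (hF : ∀ x, F (x + q) = F x) (hF1 : ∀ x, ‖F x‖ ≤ 1)
    (hg : ∀ x y, x ≤ 2 * N → y ≤ 2 * N → ‖g x - g y‖ ≤ L * |(x : ℝ) - y|) (M : ℕ) (hM : q * M ≤ N) :
    ‖∑ x ∈ range (2 * (q * M)), F x * g x - 2 * ∑ x ∈ range (q * M), F x * g (2 * x)‖ ≤ M * (2 * q * (L * q)) := by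
  have hFm : ∀ m b, F (q * m + b) = F b := by
    intro m b
    induction m with
    | zero => simp
    | succ m ih => rw [← ih, ← hF (q * m + b)]; congr 1; ring
  induction M with
  | zero => simp
  | succ M ih =>
    have ih := ih (le_trans (Nat.mul_le_mul_left _ (by omega)) hM)
    have e1 : 2 * (q * (M + 1)) = 2 * (q * M) + q + q := by ring
    have e2 : q * (M + 1) = q * M + q := by ring
    rw [e2] at hM
    rw [e1, e2, sum_range_add, sum_range_add, sum_range_add]
    have key : ‖∑ b ∈ range q, F (2 * (q * M) + b) * g (2 * (q * M) + b) +
        ∑ b ∈ range q, F (2 * (q * M) + q + b) * g (2 * (q * M) + q + b) -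
        2 * ∑ b ∈ range q, F (q * M + b) * g (2 * (q * M + b))‖ ≤ 2 * q * (L * q) := by
      rw [mul_sum, ← sum_add_distrib, ← sum_sub_distrib]
      refine (norm_sum_le _ _).trans ?_
      refine (sum_le_card_nsmul _ _ (2 * (L * q)) ?_).trans (by rw [card_range, nsmul_eq_mul]; exact le_of_eq (by ring))
      intro b hb
      rw [mem_range] at hb
      have f1 : F (2 * (q * M) + b) = F b := by rw [← hFm (2 * M) b]; congr 1; ring
      have f2 : F (2 * (q * M) + q + b) = F b := by rw [← hFm (2 * M + 1) b]; congr 1; ring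
      rw [f1, f2, hFm]
      have e : F b * g (2 * (q * M) + b) + F b * g (2 * (q * M) + q + b) - 2 * (F b * g (2 * (q * M + b))) =
        F b * ((g (2 * (q * M) + b) - g (2 * (q * M + b))) + (g (2 * (q * M) + q + b) - g (2 * (q * M + b)))) := by ring
      rw [e, norm_mul]
      have hbq : (b : ℝ) < q := by exact_mod_cast hb
      have hb0 : (0 : ℝ) ≤ b := by positivity
      have g1 := hg (2 * (q * M) + b) (2 * (q * M + b)) (by omega) (by omega)
      have g2 := hg (2 * (q * M) + q + b) (2 * (q * M + b)) (by omega) (by omega)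
      have a1 : |((2 * (q * M) + b : ℕ) : ℝ) - (2 * (q * M + b) : ℕ)| ≤ q := by
        push_cast; rw [abs_le]; constructor <;> linarith
      have a2 : |((2 * (q * M) + q + b : ℕ) : ℝ) - (2 * (q * M + b) : ℕ)| ≤ q := by
        push_cast; rw [abs_le]; constructor <;> linarith
      have g1' := g1.trans (mul_le_mul_of_nonneg_left a1 hL)
      have g2' := g2.trans (mul_le_mul_of_nonneg_left a2 hL)
      calc ‖F b‖ * _ ≤ 1 * (L * q + L * q) := by
            gcongr
            · exact hF1 b
            · exact (norm_add_le _ _).trans (add_le_add g1' g2')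
        _ = _ := by ring
    set A := ∑ x ∈ range (2 * (q * M)), F x * g x
    set B := ∑ x ∈ range (q * M), F x * g (2 * x)
    set a := ∑ b ∈ range q, F (2 * (q * M) + b) * g (2 * (q * M) + b)
    set b := ∑ b ∈ range q, F (2 * (q * M) + q + b) * g (2 * (q * M) + q + b)
    set c := ∑ b ∈ range q, F (q * M + b) * g (2 * (q * M + b))
    have : A + a + b - 2 * (B + c) = (A - 2 * B) + (a + b - 2 * c) := by ring
    rw [this]
    refine (norm_add_le _ _).trans ((add_le_add ih key).trans (le_of_eq ?_))
    push_cast; ring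

lemma per_sum' (F g : ℕ → ℂ) (q : ℕ) (hq : 1 ≤ q) (N : ℕ) (L : ℝ) (hL : 0 ≤ L)
    (hF : ∀ x, F (x + q) = F x) (hF1 : ∀ x, ‖F x‖ ≤ 1) (hg1 : ∀ x, ‖g x‖ ≤ 1)
    (hg : ∀ x y, x ≤ 2 * N → y ≤ 2 * N → ‖g x - g y‖ ≤ L * |(x : ℝ) - y|) :
    ‖∑ x ∈ Icc 1 (2 * N), F x * g x - 2 * ∑ x ∈ Icc 1 N, F x * g (2 * x)‖ ≤ 2 * N * q * L + 10 * q := by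
  have h0 : ∀ (h : ℕ → ℂ) (P : ℕ), ∑ x ∈ Icc 1 P, h x = ∑ x ∈ range P, h x + (h P - h 0) := by
    intro h P
    rw [sum_Icc_range, ← Finset.sum_range_sub, ← sum_add_distrib]
    refine sum_congr rfl fun i _ => ?_
    ring
  have hdm := Nat.div_add_mod N q
  have hml := Nat.mod_lt N hq
  have hMN : q * (N / q) ≤ N := Nat.mul_div_le N q
  have key := per_sum F g q hq N L hL hF hF1 hg (N / q) hMN
  have n1 : ∀ x, ‖F x * g x‖ ≤ 1 := fun x => by
    rw [norm_mul]; exact mul_le_one₀ (hF1 x) (norm_nonneg _) (hg1 x)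
  have n2 : ∀ x, ‖F x * g (2 * x)‖ ≤ 1 := fun x => by
    rw [norm_mul]; exact mul_le_one₀ (hF1 x) (norm_nonneg _) (hg1 _)
  rw [h0 (fun x => F x * g x), h0 (fun x => F x * g (2 * x))]
  have s1 : ∑ x ∈ range (2 * N), F x * g x = ∑ x ∈ range (2 * (q * (N / q))), F x * g x +
      ∑ x ∈ range (2 * (N % q)), F (2 * (q * (N / q)) + x) * g (2 * (q * (N / q)) + x) := by
    rw [← sum_range_add (fun x => F x * g x), ← mul_add, hdm]
  have s2 : ∑ x ∈ range N, F x * g (2 * x) = ∑ x ∈ range (q * (N / q)), F x * g (2 * x) +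
      ∑ x ∈ range (N % q), F (q * (N / q) + x) * g (2 * (q * (N / q) + x)) := by
    rw [← sum_range_add (fun x => F x * g (2 * x)), hdm]
  rw [s1, s2]
  have b1 : ‖∑ x ∈ range (2 * (N % q)), F (2 * (q * (N / q)) + x) * g (2 * (q * (N / q)) + x)‖ ≤ 2 * q := by
    refine (norm_sum_le _ _).trans ((sum_le_card_nsmul _ _ 1 fun x _ => n1 _).trans ?_)
    rw [card_range, nsmul_eq_mul, mul_one]
    exact_mod_cast (by omega : 2 * (N % q) ≤ 2 * q)
  have b2 : ‖∑ x ∈ range (N % q), F (q * (N / q) + x) * g (2 * (q * (N / q) + x))‖ ≤ q := by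
    refine (norm_sum_le _ _).trans ((sum_le_card_nsmul _ _ 1 fun x _ => n2 _).trans ?_)
    rw [card_range, nsmul_eq_mul, mul_one]
    exact_mod_cast (by omega : (N % q) ≤ q)
  have b3 := norm_sub_le (F (2 * N) * g (2 * N)) (F 0 * g 0)
  have b4 := norm_sub_le (F N * g (2 * N)) (F 0 * g (2 * 0))
  have c1 := n1 (2 * N)
  have c2 := n1 0
  have c3 := n2 N
  have c4 := n2 0
  have hq1 : (1 : ℝ) ≤ q := by exact_mod_cast hq
  have hmain : ((N / q : ℕ) : ℝ) * (2 * q * (L * q)) ≤ 2 * N * q * L := by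
    have : ((N / q : ℕ) : ℝ) * q ≤ N := by
      rw [mul_comm]; exact_mod_cast hMN
    calc ((N / q : ℕ) : ℝ) * (2 * q * (L * q)) = (((N / q : ℕ) : ℝ) * q) * (2 * q * L) := by ring
      _ ≤ N * (2 * q * L) := by gcongr
      _ = _ := by ring
  set A := ∑ x ∈ range (2 * (q * (N / q))), F x * g x
  set B := ∑ x ∈ range (q * (N / q)), F x * g (2 * x)
  set a := ∑ x ∈ range (2 * (N % q)), F (2 * (q * (N / q)) + x) * g (2 * (q * (N / q)) + x)
  set b := ∑ x ∈ range (N % q), F (q * (N / q) + x) * g (2 * (q * (N / q) + x))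
  set u := F (2 * N) * g (2 * N) - F 0 * g 0
  set v := F N * g (2 * N) - F 0 * g (2 * 0)
  have : A + a + u - 2 * (B + b + v) = (A - 2 * B) + (a + u) - 2 * (b + v) := by ring
  rw [this]
  have t1 := norm_sub_le ((A - 2 * B) + (a + u)) (2 * (b + v))
  have t2 := norm_add_le (A - 2 * B) (a + u)
  have t3 := norm_add_le a u
  have t4 : ‖2 * (b + v)‖ ≤ 2 * (‖b‖ + ‖v‖) := by
    rw [norm_mul]; simp; exact norm_add_le b v
  linarith

/-- dilation about r -/
def dil {k : ℕ} (r α : Fin k → ℝ) : Fin k → ℝ := fun j => r j + 2 ^ ((j : ℕ) + 1) * (α j - r j)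

lemma transfer {k : ℕ} (N : ℕ) (hN : 1 ≤ N) (q : ℕ) (hq : 1 ≤ q) (W : ℝ) (hW : 1 ≤ W) (hqW : (q : ℝ) ≤ W)
    (r α : Fin k → ℝ) (a : Fin k → ℤ) (hr : ∀ j, q * r j = a j)
    (hα : ∀ j, |α j - r j| ≤ W / ((2 * N : ℕ) : ℝ) ^ ((j : ℕ) + 1)) :
    ‖fs (2 * N) α - 2 * fs N (dil r α)‖ ≤ (7 * k ^ 2 + 10) * W ^ 2 := by
  set β : Fin k → ℝ := fun j => α j - r j with hβ
  have hP0 : (0 : ℝ) < ((2 * N : ℕ) : ℝ) := by exact_mod_cast (by omega : 0 < 2 * N)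
  have hpi := Real.pi_pos
  set P : ℕ := 2 * N with hP
  have key := per_sum' (fun x => ee (ph r (pv k x))) (fun x => ee (ph β (pv k x))) q hq N (2 * Real.pi * (k * (k * (W / P))))
    (by positivity) ?_ (fun x => (ee_norm _).le) (fun x => (ee_norm _).le) ?_
  · have e1 : fs P α = ∑ x ∈ Icc 1 P, ee (ph r (pv k x)) * ee (ph β (pv k x)) := by
      unfold fs ES
      refine sum_congr rfl fun x _ => ?_
      rw [← ee_add]
      congr 1
      unfold ph
      rw [← sum_add_distrib]
      refine sum_congr rfl fun j _ => ?_
      rw [hβ]; ring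
    have e2 : fs N (dil r α) = ∑ x ∈ Icc 1 N, ee (ph r (pv k x)) * ee (ph β (pv k (2 * x))) := by
      unfold fs ES
      refine sum_congr rfl fun x _ => ?_
      rw [← ee_add]
      congr 1
      unfold ph
      rw [← sum_add_distrib]
      refine sum_congr rfl fun j _ => ?_
      simp only [hβ, dil, pv]
      push_cast; rw [mul_pow]; ring
    rw [e1, e2]
    refine key.trans ?_
    have h7 : 2 * Real.pi ≤ 7 := by have := Real.pi_lt_d2; linarith
    have hq0 : (0 : ℝ) ≤ q := by positivity
    have e3 : 2 * (N : ℝ) * q * (2 * Real.pi * (k * (k * (W / P)))) = 2 * Real.pi * k ^ 2 * (q * W) := by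
      have : (P : ℝ) = 2 * N := by rw [hP]; push_cast; rfl
      have hN0 : (N : ℝ) ≠ 0 := by exact_mod_cast (by omega : N ≠ 0)
      rw [this]; field_simp
    rw [e3]
    calc 2 * Real.pi * k ^ 2 * (q * W) + 10 * q ≤ 7 * k ^ 2 * (W * W) + 10 * (W * W) := by
          gcongr
          nlinarith
      _ = _ := by ring
  · intro x
    have : ∃ n : ℤ, ph r (pv k (x + q)) = ph r (pv k x) + n := by
      have hd : ∀ j : Fin k, ∃ m : ℤ, ((x + q : ℕ) : ℤ) ^ ((j : ℕ) + 1) = (x : ℤ) ^ ((j : ℕ) + 1) + q * m := by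
        intro j
        obtain ⟨m, hm⟩ := sub_dvd_pow_sub_pow ((x + q : ℕ) : ℤ) (x : ℤ) ((j : ℕ) + 1)
        refine ⟨m, ?_⟩
        push_cast at hm ⊢
        rw [add_sub_cancel_left] at hm
        linarith
      choose m hm using hd
      refine ⟨∑ j, a j * m j, ?_⟩
      unfold ph
      push_cast
      rw [← sum_add_distrib]
      refine sum_congr rfl fun j _ => ?_
      have := hm j
      simp only [pv]
      rw [this]
      push_cast
      rw [← hr]; ring
    obtain ⟨n, hn⟩ := this
    rw [hn, ee_add, ee_int, mul_one]
  · intro x y hx hy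
    refine (ee_sub_le _ _).trans ?_
    rw [mul_assoc (2 * Real.pi)]
    gcongr
    unfold ph
    rw [← sum_sub_distrib]
    refine (abs_sum_le_sum_abs _ _).trans ?_
    refine (sum_le_card_nsmul _ _ (k * (W / P) * |(x : ℝ) - y|) ?_).trans (by
      rw [card_univ, Fintype.card_fin, nsmul_eq_mul, ← mul_assoc])
    intro j _
    rw [← mul_sub, abs_mul]
    simp only [pv]
    push_cast
    have hx' : (x : ℝ) ≤ P := by exact_mod_cast hx
    have hy' : (y : ℝ) ≤ P := by exact_mod_cast hy
    have hj : (((j : ℕ) + 1 : ℕ) : ℝ) ≤ k := by exact_mod_cast j.2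
    have h1 := abs_pow_sub_pow_le (x : ℝ) (y : ℝ) ((j : ℕ) + 1)
    have h2 : max |(x : ℝ)| |(y : ℝ)| ^ ((j : ℕ) + 1 - 1) ≤ (P : ℝ) ^ (j : ℕ) := by
      rw [Nat.add_sub_cancel]
      gcongr
      rw [abs_of_nonneg (by positivity), abs_of_nonneg (by positivity)]
      exact max_le hx' hy'
    calc |β j| * |(x : ℝ) ^ ((j : ℕ) + 1) - (y : ℝ) ^ ((j : ℕ) + 1)| ≤
        (W / (P : ℝ) ^ ((j : ℕ) + 1)) * (|(x : ℝ) - y| * k * (P : ℝ) ^ (j : ℕ)) := by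
          gcongr
          · exact hα j
          · exact h1.trans (by gcongr)
      _ = _ := by rw [pow_succ]; field_simp

end TV

noncomputable section TV

open Finset MeasureTheory

lemma map_dil {k : ℕ} (r : Fin k → ℝ) :
    Measure.map (dil r) (volume : Measure (Fin k → ℝ)) = ENNReal.ofReal ((2 : ℝ) ^ (-kap k)) • volume := by
  set d : Fin k → ℝ := fun j => 2 ^ ((j : ℕ) + 1) with hd
  have hdet : (Matrix.diagonal d).det = (2 : ℝ) ^ kap k := by
    rw [Matrix.det_diagonal, ← sum_kap, Real.rpow_sum_of_pos (by norm_num)]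
    refine prod_congr rfl fun j _ => ?_
    rw [Real.rpow_natCast]
  have h2 : (0 : ℝ) < (2 : ℝ) ^ kap k := by positivity
  have h1 := Real.map_matrix_volume_pi_eq_smul_volume_pi (M := Matrix.diagonal d) (by rw [hdet]; exact h2.ne')
  rw [hdet, abs_of_pos (by positivity), ← Real.rpow_neg (by norm_num)] at h1
  have e : dil r = (fun x => x + (fun j => r j - 2 ^ ((j : ℕ) + 1) * r j)) ∘ (Matrix.toLin' (Matrix.diagonal d)) := by
    funext α j
    simp [dil, hd, Matrix.mulVec_diagonal]
    ring
  rw [e, ← Measure.map_map (by fun_prop) (by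
    exact (LinearMap.continuous_of_finiteDimensional _).measurable), h1, Measure.map_smul, map_add_right_eq_self]

lemma meas_dil {k : ℕ} (r : Fin k → ℝ) : Measurable (dil r) := by
  unfold dil; fun_prop

lemma lint_dil {k : ℕ} (r : Fin k → ℝ) (h : (Fin k → ℝ) → ENNReal) (hh : Measurable h) :
    ∫⁻ α, h (dil r α) = ENNReal.ofReal ((2 : ℝ) ^ (-kap k)) * ∫⁻ α, h α := by
  rw [← lintegral_map hh (meas_dil r), map_dil, lintegral_smul_measure, smul_eq_mul]

lemma lint_J (k n P : ℕ) (c : ℝ) :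
    ∫⁻ α in (Set.pi Set.univ fun _ : Fin k => Set.Ioc c (c + 1)), ENNReal.ofReal (‖fs P α‖ ^ (2 * n)) = ENNReal.ofReal (J k n P) := by
  have h := int_J k n P c 1
  have h0 := mu_eq k c 1
  rw [Nat.cast_one] at h0
  rw [← h0, ← ofReal_integral_eq_lintegral_ofReal, h]
  · simp
  · exact bdd_integrable c 1 (by have := ES_cont (Icc 1 P) (pv k); fun_prop)
  · exact Filter.Eventually.of_forall fun x => by positivity

lemma abs_step {k : ℕ} (N s t : ℕ) (hst : s ≤ t) (c Λ g : ℝ) (hΛ : 0 ≤ Λ) (hg : 0 ≤ g) (R : Finset (Fin k → ℝ)) (B : (Fin k → ℝ) → Set (Fin k → ℝ))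
    (hBm : ∀ r ∈ R, MeasurableSet (B r))
    (hBD : ∀ r ∈ R, B r ⊆ Set.pi Set.univ fun _ : Fin k => Set.Ioc c (c + 1))
    (hdis : ∀ r ∈ R, ∀ r' ∈ R, r ≠ r' → Disjoint (B r) (B r'))
    (hmaj : ∀ α ∈ Set.pi Set.univ (fun _ : Fin k => Set.Ioc c (c + 1)), Λ ≤ ‖fs (2 * N) α‖ →
      ∃ r ∈ R, dil r α ∈ B r ∧ ‖fs (2 * N) α‖ ≤ g * (2 * ‖fs N (dil r α)‖)) :
    (J k t (2 * N) : ℝ) ≤ Λ ^ (2 * (t - s)) * J k s (2 * N) + (g * 2) ^ (2 * t) * (2 : ℝ) ^ (-kap k) * J k t N := by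
  set D := Set.pi Set.univ (fun _ : Fin k => Set.Ioc c (c + 1)) with hD
  have hDm : MeasurableSet D := MeasurableSet.univ_pi fun _ => measurableSet_Ioc
  set Fn : (Fin k → ℝ) → ENNReal := fun α => ENNReal.ofReal (‖fs N α‖ ^ (2 * t)) with hFn
  have hmF : Measurable Fn := by
    have : Continuous (fun α : Fin k → ℝ => ‖fs N α‖ ^ (2 * t)) := by
      have := ES_cont (Icc 1 N) (pv k); fun_prop
    exact this.measurable.ennreal_ofReal
  have hmP : Measurable (fun α : Fin k → ℝ => ENNReal.ofReal (‖fs (2 * N) α‖ ^ (2 * s))) := by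
    have : Continuous (fun α : Fin k → ℝ => ‖fs (2 * N) α‖ ^ (2 * s)) := by
      have := ES_cont (Icc 1 (2 * N)) (pv k); fun_prop
    exact this.measurable.ennreal_ofReal
  have hpt : ∀ α ∈ D, ENNReal.ofReal (‖fs (2 * N) α‖ ^ (2 * t)) ≤
      ENNReal.ofReal (Λ ^ (2 * (t - s))) * ENNReal.ofReal (‖fs (2 * N) α‖ ^ (2 * s)) +
      ENNReal.ofReal ((g * 2) ^ (2 * t)) * ∑ r ∈ R, (B r).indicator Fn (dil r α) := by
    intro α hα
    rcases le_total Λ ‖fs (2 * N) α‖ with h | h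
    · obtain ⟨r, hr, hrB, hle⟩ := hmaj α hα h
      refine le_trans ?_ le_add_self
      refine le_trans ?_ (mul_le_mul_right (single_le_sum (f := fun r => (B r).indicator Fn (dil r α)) (fun _ _ => zero_le) hr) _)
      rw [Set.indicator_of_mem hrB, hFn, ← ENNReal.ofReal_mul (by positivity), ← mul_pow]
      apply ENNReal.ofReal_le_ofReal
      gcongr
      linarith
    · refine le_trans ?_ le_self_add
      rw [← ENNReal.ofReal_mul (by positivity)]
      apply ENNReal.ofReal_le_ofReal
      calc ‖fs (2 * N) α‖ ^ (2 * t) = ‖fs (2 * N) α‖ ^ (2 * (t - s)) * ‖fs (2 * N) α‖ ^ (2 * s) := by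
            rw [← pow_add]; congr 1; omega
        _ ≤ _ := by gcongr
  have hmI : ∀ r ∈ R, Measurable (fun α => (B r).indicator Fn (dil r α)) := fun r hr =>
    (hmF.indicator (hBm r hr)).comp (meas_dil r)
  have hsum : ∫⁻ α in D, ∑ r ∈ R, (B r).indicator Fn (dil r α) ≤ ENNReal.ofReal ((2 : ℝ) ^ (-kap k)) * ENNReal.ofReal (J k t N) := by
    calc ∫⁻ α in D, ∑ r ∈ R, (B r).indicator Fn (dil r α) ≤ ∫⁻ α, ∑ r ∈ R, (B r).indicator Fn (dil r α) := setLIntegral_le_lintegral _ _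
      _ = ∑ r ∈ R, ∫⁻ α, (B r).indicator Fn (dil r α) := lintegral_finsetSum' _ fun r hr => (hmI r hr).aemeasurable
      _ = ∑ r ∈ R, ENNReal.ofReal ((2 : ℝ) ^ (-kap k)) * ∫⁻ α in B r, Fn α := by
          refine sum_congr rfl fun r hr => ?_
          rw [lint_dil r ((B r).indicator Fn) (hmF.indicator (hBm r hr)), lintegral_indicator (hBm r hr)]
      _ = ENNReal.ofReal ((2 : ℝ) ^ (-kap k)) * ∫⁻ α in ⋃ r ∈ R, B r, Fn α := by
          rw [← mul_sum, lintegral_biUnion_finset]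
          · intro r hr r' hr' hne
            exact hdis r hr r' hr' hne
          · exact hBm
      _ ≤ ENNReal.ofReal ((2 : ℝ) ^ (-kap k)) * ∫⁻ α in D, Fn α := by
          gcongr
          exact Set.iUnion₂_subset hBD
      _ = _ := by rw [hFn, hD, lint_J]
  have hfin := setLIntegral_mono' (μ := volume) hDm hpt
  rw [hD, lint_J, ← hD, lintegral_add_left (by exact hmP.const_mul _), lintegral_const_mul _ hmP, hD, lint_J, ← hD,
    lintegral_const_mul _ (by exact Finset.measurable_fun_sum R hmI)] at hfin
  have hfin2 := hfin.trans (add_le_add_right (mul_le_mul_right hsum _) _)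
  rw [← ENNReal.ofReal_mul (by positivity), ← ENNReal.ofReal_mul (by positivity), ← ENNReal.ofReal_mul (by positivity),
    ← ENNReal.ofReal_add (by positivity) (by positivity), ENNReal.ofReal_le_ofReal_iff (by positivity)] at hfin2
  rw [mul_assoc]
  exact hfin2

end TV

noncomputable section TV

open Finset MeasureTheory

lemma rat_sep (q q' : ℕ) (a a' : ℕ) (hq : 1 ≤ q) (hq' : 1 ≤ q') (W : ℝ) (hW : 1 ≤ W) (h1 : (q : ℝ) ≤ W) (h2 : (q' : ℝ) ≤ W)
    (hne : (a : ℝ) / q ≠ (a' : ℝ) / q') : 1 / W ^ 2 ≤ |(a : ℝ) / q - (a' : ℝ) / q'| := by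
  have hq0 : (0 : ℝ) < q := by exact_mod_cast hq
  have hq0' : (0 : ℝ) < q' := by exact_mod_cast hq'
  have e : (a : ℝ) / q - (a' : ℝ) / q' = ((a * q' - q * a' : ℤ) : ℝ) / (q * q') := by
    push_cast; field_simp
  have hz : (a * q' - q * a' : ℤ) ≠ 0 := by
    intro h
    rw [h] at e
    simp at e
    exact hne (sub_eq_zero.1 e)
  rw [e, abs_div, abs_of_pos (show (0 : ℝ) < q * q' by positivity)]
  have : (1 : ℝ) ≤ |((a * q' - q * a' : ℤ) : ℝ)| := by
    rw [← Int.cast_abs]; exact_mod_cast Int.one_le_abs hz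
  gcongr
  rw [pow_two]; gcongr

lemma step {k : ℕ} (N s t : ℕ) (hst : s ≤ t) (hN : 1 ≤ N) (W Λ E : ℝ) (hW : 1 ≤ W) (hWN : 2 * W ^ 3 < N) (hΛ : 0 < Λ)
    (hEd : E = (7 * k ^ 2 + 10) * W ^ 2) (hE : 2 * E ≤ Λ)
    (hstr : ∀ α : Fin k → ℝ, Λ ≤ ‖fs (2 * N) α‖ → ∃ Q : ℕ, 1 ≤ Q ∧ (Q : ℝ) ≤ W ∧ ∀ i : Fin k,
      nz (Q * α i) (W / ((2 * N : ℕ) : ℝ) ^ ((i : ℕ) + 1))) :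
    (J k t (2 * N) : ℝ) ≤ Λ ^ (2 * (t - s)) * J k s (2 * N) +
      ((1 + 2 * (E / Λ)) * 2) ^ (2 * t) * (2 : ℝ) ^ (-kap k) * J k t N := by
  classical
  have hE0 : 0 < E := by rw [hEd]; positivity
  have hN0 : (0 : ℝ) < N := by exact_mod_cast hN
  have hN1 : (1 : ℝ) ≤ N := by exact_mod_cast hN
  have hW0 : 0 < W := by linarith
  have hW2 : W ^ 2 ≤ W ^ 3 := pow_le_pow_right₀ hW (by norm_num)
  set w := 1 / (2 * W) with hw
  have hw0 : 0 < w := by positivity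
  have hww : 1 / W = 2 * w := by rw [hw]; field_simp
  have hWw : W / N < w := by
    rw [hw, div_lt_div_iff₀ hN0 (by positivity)]; nlinarith
  have hWN1 : ∀ j : ℕ, W / (N : ℝ) ^ (j + 1) ≤ W / N := by
    intro j
    gcongr
    exact le_self_pow₀ hN1 (by omega)
  have hWP1 : ∀ j : ℕ, W / ((2 * N : ℕ) : ℝ) ^ (j + 1) ≤ W / (N : ℝ) ^ (j + 1) := by
    intro j
    gcongr
    push_cast; linarith
  set R : Finset (Fin k → ℝ) := (Icc 1 ⌊W⌋₊).biUnion fun Q =>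
    (Fintype.piFinset fun _ : Fin k => range Q).image fun a i => (a i : ℝ) / Q with hR
  have hRmem : ∀ r, r ∈ R ↔ ∃ Q : ℕ, 1 ≤ Q ∧ (Q : ℝ) ≤ W ∧ ∃ a : Fin k → ℕ, (∀ i, a i < Q) ∧ ∀ i, r i = (a i : ℝ) / Q := by
    intro r
    rw [hR, mem_biUnion]
    constructor
    · rintro ⟨Q, hQ, hr⟩
      rw [mem_Icc, Nat.le_floor_iff hW0.le] at hQ
      rw [mem_image] at hr
      obtain ⟨a, ha, rfl⟩ := hr
      rw [Fintype.mem_piFinset] at ha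
      exact ⟨Q, hQ.1, hQ.2, a, fun i => mem_range.1 (ha i), fun i => rfl⟩
    · rintro ⟨Q, hQ, hQ2, a, ha, hr⟩
      refine ⟨Q, by rw [mem_Icc, Nat.le_floor_iff hW0.le]; exact ⟨hQ, hQ2⟩, ?_⟩
      rw [mem_image]
      exact ⟨a, by rw [Fintype.mem_piFinset]; exact fun i => mem_range.2 (ha i), by funext i; rw [hr]⟩
  set B : (Fin k → ℝ) → Set (Fin k → ℝ) := fun r => Set.pi Set.univ fun j => Set.Icc (r j - W / (N : ℝ) ^ ((j : ℕ) + 1)) (r j + W / (N : ℝ) ^ ((j : ℕ) + 1)) with hB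
  have hBmem : ∀ r β, β ∈ B r ↔ ∀ j, |β j - r j| ≤ W / (N : ℝ) ^ ((j : ℕ) + 1) := by
    intro r β
    simp only [hB, Set.mem_pi, Set.mem_univ, true_imp_iff, Set.mem_Icc]
    refine forall_congr' fun j => ?_
    rw [abs_le]
    constructor
    · rintro ⟨h1, h2⟩; constructor <;> linarith
    · rintro ⟨h1, h2⟩; constructor <;> linarith
  refine abs_step N s t hst (-w) Λ (1 + 2 * (E / Λ)) hΛ.le (by positivity) R B ?_ ?_ ?_ ?_
  · intro r hr
    exact MeasurableSet.univ_pi fun _ => measurableSet_Icc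
  · intro r hr β hβ
    rw [hRmem] at hr
    obtain ⟨Q, hQ1, hQW, a, ha, hra⟩ := hr
    rw [hBmem] at hβ
    rw [Set.mem_pi]
    intro j _
    have h1 := (hβ j).trans (hWN1 j)
    have hQ0 : (0 : ℝ) < Q := by exact_mod_cast hQ1
    have h2 : 0 ≤ r j := by rw [hra]; positivity
    have h3 : r j ≤ 1 - 1 / W := by
      have h4 : r j ≤ 1 - 1 / Q := by
        rw [hra, div_le_iff₀ hQ0]
        have : (a j : ℝ) + 1 ≤ Q := by exact_mod_cast ha j
        have : (1 - 1 / (Q : ℝ)) * Q = Q - 1 := by field_simp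
        linarith
      have : 1 / W ≤ 1 / (Q : ℝ) := one_div_le_one_div_of_le hQ0 hQW
      linarith
    rw [abs_le] at h1
    constructor <;> linarith
  · intro r hr r' hr' hne
    rw [Set.disjoint_left]
    intro β hβ hβ'
    rw [hRmem] at hr hr'
    rw [hBmem] at hβ hβ'
    obtain ⟨Q, hQ1, hQW, a, ha, hra⟩ := hr
    obtain ⟨Q', hQ1', hQW', a', ha', hra'⟩ := hr'
    obtain ⟨j, hj⟩ : ∃ j, r j ≠ r' j := by
      by_contra h; push Not at h; exact hne (funext h)
    have h1 := (hβ j).trans (hWN1 j)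
    have h1' := (hβ' j).trans (hWN1 j)
    have h2 := rat_sep Q Q' (a j) (a' j) hQ1 hQ1' W hW hQW hQW' (by rw [← hra, ← hra']; exact hj)
    rw [← hra, ← hra'] at h2
    have h3 : |r j - r' j| ≤ 2 * (W / N) := by
      rw [abs_le] at *; constructor <;> linarith
    have h4 : 2 * (W / N) < 1 / W ^ 2 := by
      rw [← mul_div_assoc, div_lt_div_iff₀ hN0 (by positivity)]; linarith
    linarith
  · intro α hα hΛα
    rw [Set.mem_pi] at hα
    obtain ⟨Q, hQ1, hQW, hn⟩ := hstr α hΛα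
    have hQ0 : (0 : ℝ) < Q := by exact_mod_cast hQ1
    have hQ1' : (1 : ℝ) ≤ Q := by exact_mod_cast hQ1
    choose n hn using hn
    have hcl : ∀ i, |α i - (n i : ℝ) / Q| ≤ W / ((2 * N : ℕ) : ℝ) ^ ((i : ℕ) + 1) := by
      intro i
      have e : α i - (n i : ℝ) / Q = (Q * α i - n i) / Q := by field_simp
      rw [e, abs_div, abs_of_pos hQ0]
      exact (div_le_self (abs_nonneg _) hQ1').trans (hn i)
    have hrange : ∀ i, 0 ≤ n i ∧ n i < Q := by
      intro i
      have h1 := ((hcl i).trans (hWP1 i)).trans (hWN1 i)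
      have h2 := hα i (Set.mem_univ _)
      rw [abs_le] at h1
      obtain ⟨h3, h4⟩ := h2
      constructor
      · have h5 : -(1 / W) < (n i : ℝ) / Q := by linarith
        rw [lt_div_iff₀ hQ0] at h5
        have h6 : 1 / W * Q ≤ 1 := by rw [one_div_mul_eq_div, div_le_one hW0]; exact hQW
        have h7 : ((-1 : ℤ) : ℝ) < n i := by push_cast; linarith
        have := Int.cast_lt.1 h7
        omega
      · have h5 : (n i : ℝ) / Q < 1 := by linarith
        rw [div_lt_one hQ0] at h5
        exact_mod_cast h5
    set r : Fin k → ℝ := fun i => (n i : ℝ) / Q with hr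
    refine ⟨r, ?_, ?_, ?_⟩
    · rw [hRmem]
      refine ⟨Q, hQ1, hQW, fun i => (n i).toNat, fun i => ?_, fun i => ?_⟩
      · have := hrange i; dsimp only; omega
      · have : (((n i).toNat : ℤ) : ℝ) = n i := by rw [Int.toNat_of_nonneg (hrange i).1]
        simp only [hr]; rw [← this, Int.cast_natCast]
    · rw [hBmem]
      intro j
      have e : dil r α j - r j = 2 ^ ((j : ℕ) + 1) * (α j - r j) := by simp [dil]
      rw [e, abs_mul, abs_of_pos (by positivity)]
      calc (2 : ℝ) ^ ((j : ℕ) + 1) * |α j - r j| ≤ 2 ^ ((j : ℕ) + 1) * (W / ((2 * N : ℕ) : ℝ) ^ ((j : ℕ) + 1)) := by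
            gcongr; exact hcl j
        _ = _ := by push_cast; rw [mul_pow]; field_simp
    · have h1 := transfer N hN Q hQ1 W hW hQW r α n (fun j => by rw [hr]; field_simp) hcl
      rw [← hEd] at h1
      have h2 : ‖fs (2 * N) α‖ ≤ 2 * ‖fs N (dil r α)‖ + E := by
        have := norm_sub_norm_le (fs (2 * N) α) (2 * fs N (dil r α))
        rw [norm_mul] at this
        simp at this
        linarith
      set y := ‖fs (2 * N) α‖
      set z := 2 * ‖fs N (dil r α)‖
      set x := E / Λ with hx
      have hx0 : 0 < x := by positivity
      have hx1 : x ≤ 1 / 2 := by rw [hx, div_le_iff₀ hΛ]; linarith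
      have hEx : E ≤ x * y := by
        have : E = x * Λ := by rw [hx]; field_simp
        rw [this]; gcongr
      have hz : (1 - x) * y ≤ z := by linarith
      have hy : 0 ≤ y := norm_nonneg _
      calc y ≤ (1 + 2 * x) * ((1 - x) * y) := by
            have : 1 ≤ (1 + 2 * x) * (1 - x) := by nlinarith
            nlinarith
        _ ≤ _ := by gcongr

end TV

noncomputable section TV

open Finset MeasureTheory

lemma rec_bdd (u : ℕ → ℝ) (hu : ∀ n, 0 ≤ u n) (C ρ : ℝ) (hC : 0 ≤ C) (hρ : 0 ≤ ρ) (hρ1 : ρ < 1) (n0 : ℕ)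
    (h : ∀ n, n0 ≤ n → u (n + 1) ≤ (1 + C * ρ ^ n) * u n + C * ρ ^ n) : ∃ B, 0 < B ∧ ∀ n, u n ≤ B := by
  have h1 : ∀ m, 1 + u (n0 + m) ≤ (1 + u n0) * Real.exp (∑ i ∈ range m, C * ρ ^ i) := by
    intro m
    induction m with
    | zero => simp
    | succ m ih =>
      rw [sum_range_succ, Real.exp_add]
      have h2 := h (n0 + m) (by omega)
      have h3 : C * ρ ^ (n0 + m) ≤ C * ρ ^ m := by
        gcongr ?_ * ?_
        exact pow_le_pow_of_le_one hρ hρ1.le (by omega)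
      have h4 : 0 ≤ C * ρ ^ (n0 + m) := by positivity
      have h5 := Real.add_one_le_exp (C * ρ ^ m)
      have hu' := hu (n0 + m)
      calc 1 + u (n0 + (m + 1)) ≤ (1 + u (n0 + m)) * (1 + C * ρ ^ (n0 + m)) := by
            rw [← add_assoc]; nlinarith
        _ ≤ ((1 + u n0) * Real.exp (∑ i ∈ range m, C * ρ ^ i)) * Real.exp (C * ρ ^ m) := by
            have h6 := hu n0
            exact mul_le_mul ih (by linarith) (by positivity) (by positivity)
        _ = _ := by ring
  have h2 : ∀ m, ∑ i ∈ range m, C * ρ ^ i ≤ C * (1 - ρ)⁻¹ := by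
    intro m
    rw [← mul_sum]
    gcongr
    rw [← tsum_geometric_of_lt_one hρ hρ1]
    exact (summable_geometric_of_lt_one hρ hρ1).sum_le_tsum _ fun i _ => by positivity
  refine ⟨(1 + u n0) * Real.exp (C * (1 - ρ)⁻¹) + ∑ i ∈ range n0, u i, ?_, ?_⟩
  · have := hu n0
    have : 0 ≤ ∑ i ∈ range n0, u i := sum_nonneg fun i _ => hu i
    positivity
  · intro n
    have hA : 0 ≤ ∑ i ∈ range n0, u i := sum_nonneg fun i _ => hu i
    have h0 := hu n0
    by_cases hn : n < n0
    · have := single_le_sum (f := u) (fun i _ => hu i) (mem_range.2 hn)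
      have : 0 ≤ (1 + u n0) * Real.exp (C * (1 - ρ)⁻¹) := by positivity
      linarith
    · have h3 := h1 (n - n0)
      rw [show n0 + (n - n0) = n by omega] at h3
      have : (1 + u n0) * Real.exp (∑ i ∈ range (n - n0), C * ρ ^ i) ≤ (1 + u n0) * Real.exp (C * (1 - ρ)⁻¹) := by
        gcongr; exact h2 _
      linarith

lemma pow_lin (y x : ℝ) (hy : 0 ≤ y) (hx : 0 ≤ x) (hx1 : x ≤ 1) (m : ℕ) :
    (1 + y * x) ^ m ≤ 1 + ((1 + y) ^ m - 1) * x := by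
  induction m with
  | zero => simp
  | succ m ih =>
    have ha : 0 ≤ (1 + y) ^ m - 1 := by
      have : (1 : ℝ) ≤ (1 + y) ^ m := one_le_pow₀ (by linarith)
      linarith
    rw [pow_succ, pow_succ]
    set a := (1 + y) ^ m - 1 with hadef
    have e : (1 + y) ^ m = 1 + a := by rw [hadef]; ring
    rw [e]
    calc (1 + y * x) ^ m * (1 + y * x) ≤ (1 + a * x) * (1 + y * x) := by gcongr
      _ = 1 + (a + y) * x + a * y * (x * x) := by ring
      _ ≤ 1 + (a + y) * x + a * y * (x * 1) := by gcongr
      _ = _ := by ring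

lemma J_mono {k n P P' : ℕ} (h : P ≤ P') : J k n P ≤ J k n P' := by
  unfold J Jx
  refine En_mono id ?_ (fun x _ y _ h => h) (fun x _ => rfl)
  intro x hx
  simp only [Fintype.mem_piFinset, mem_Icc, id] at hx ⊢
  exact fun i => ⟨(hx i).1, (hx i).2.trans h⟩

set_option maxHeartbeats 1600000 in
lemma sharp {k : ℕ} (hk : 2 ≤ k) (s t : ℕ) (C η ε δ : ℝ) (hC : 0 < C) (hδ : 0 < δ) (hδ1 : δ < 1 / 2) (hε : 0 < ε)
    (hδε : δ < ε) (hpar : η + δ * (k + 2 * s) < ε) (hσ : ε * ((2 * k + 6) * (k + 2)) ≤ 1 / 16) (hst : s ≤ t)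
    (hη : η < 2 * δ * ((t : ℝ) - s)) (hκ : kap k ≤ 2 * t)
    (hJ : ∀ P : ℕ, 1 ≤ P → (J k s P : ℝ) ≤ C * (P : ℝ) ^ (2 * (s : ℝ) - kap k + η)) :
    ∃ C', 0 < C' ∧ ∀ P : ℕ, 1 ≤ P → (J k t P : ℝ) ≤ C' * (P : ℝ) ^ (2 * (t : ℝ) - kap k) := by
  set c0 : ℝ := 7 * k ^ 2 + 10 with hc0
  have hc0' : 0 < c0 := by positivity
  set θ1 : ℝ := 1 - δ - 1 / 8 with hθ1
  set θ2 : ℝ := 2 * δ * ((t : ℝ) - s) - η with hθ2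
  set θ := min θ1 θ2 with hθ
  have hθ0 : 0 < θ := lt_min (by linarith) (by linarith)
  set A : ℝ := (1 + 2 * c0) ^ (2 * t) - 1 + C with hA
  have hA1 : (0 : ℝ) ≤ (1 + 2 * c0) ^ (2 * t) - 1 := by
    have : (1 : ℝ) ≤ (1 + 2 * c0) ^ (2 * t) := one_le_pow₀ (by linarith)
    linarith
  have hev := struct_thm hk s C η ε δ (1 / 16) hC hδ (by linarith) hε hδε hpar hσ (by norm_num) hJ
  have hev2 := (hev.and ((ev_rpow (13 / 16) (by norm_num) 5).and (ev_rpow θ1 (by linarith) (2 * c0))))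
  have htend : Filter.Tendsto (fun n : ℕ => 2 * 2 ^ n) Filter.atTop Filter.atTop := by
    refine Filter.tendsto_atTop_mono (fun n => ?_) Filter.tendsto_id
    have := (Nat.lt_two_pow_self (n := n)).le
    simp only [id]; omega
  obtain ⟨n0, hn0⟩ := Filter.eventually_atTop.1 (htend.eventually hev2)
  set u : ℕ → ℝ := fun n => (J k t (2 ^ n) : ℝ) / ((2 ^ n : ℕ) : ℝ) ^ (2 * (t : ℝ) - kap k) with hu
  obtain ⟨B, hB, huB⟩ := rec_bdd u (fun n => by positivity) A ((2 : ℝ) ^ (-θ)) (by linarith) (by positivity)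
    (Real.rpow_lt_one_of_one_lt_of_neg (by norm_num) (by linarith)) n0 (by
    intro n hn
    obtain ⟨h1, h2, h3⟩ := hn0 n hn
    set N : ℕ := 2 ^ n with hN
    have hN1 : 1 ≤ N := Nat.one_le_two_pow
    have e0 : (2 : ℕ) ^ (n + 1) = 2 * N := by rw [hN, pow_succ, mul_comm]
    have hN0 : (0 : ℝ) < N := by exact_mod_cast hN1
    have hN1' : (1 : ℝ) ≤ N := by exact_mod_cast hN1
    set P : ℝ := ((2 * N : ℕ) : ℝ) with hP
    have hPN : P = 2 * N := by rw [hP]; push_cast; rfl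
    have hP0 : 0 < P := by rw [hPN]; positivity
    have hP1 : 1 ≤ P := by rw [hPN]; linarith
    have hEΛ : (c0 * (P ^ (1 / 16 : ℝ)) ^ 2) / P ^ (1 - δ) = c0 * P ^ (-θ1) := by
      rw [mul_div_assoc, ← Real.rpow_natCast, ← Real.rpow_mul hP0.le, ← Real.rpow_sub hP0]
      congr 2; rw [hθ1]; push_cast; ring
    have hst' := step N s t hst hN1 (P ^ (1 / 16 : ℝ)) (P ^ (1 - δ)) (c0 * (P ^ (1 / 16 : ℝ)) ^ 2)
      (Real.one_le_rpow hP1 (by norm_num)) (by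
        rw [← Real.rpow_natCast, ← Real.rpow_mul hP0.le]
        have : P ^ (13 / 16 : ℝ) * P ^ (1 / 16 * (3 : ℕ) : ℝ) = P := by
          rw [← Real.rpow_add hP0]; norm_num
        have h4 : (0 : ℝ) < P ^ (1 / 16 * (3 : ℕ) : ℝ) := by positivity
        nlinarith) (by positivity) rfl (by
        have : P ^ θ1 * P ^ (-θ1) = 1 := by rw [← Real.rpow_add hP0]; simp
        have h5 : (0 : ℝ) < P ^ (-θ1) := by positivity
        have h4 : 2 * (c0 * P ^ (-θ1)) ≤ 1 := by nlinarith
        rw [← hEΛ, ← mul_div_assoc, div_le_one (by positivity)] at h4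
        exact h4) h1
    rw [hEΛ] at hst'
    have hd0 : 0 < P ^ (2 * (t : ℝ) - kap k) := by positivity
    have hθle : ∀ θ', θ ≤ θ' → P ^ (-θ') ≤ ((2 : ℝ) ^ (-θ)) ^ n := by
      intro θ' hle
      calc P ^ (-θ') ≤ P ^ (-θ) := Real.rpow_le_rpow_of_exponent_le hP1 (by linarith)
        _ ≤ ((2 : ℝ) ^ n) ^ (-θ) := by
          apply Real.rpow_le_rpow_of_nonpos (by positivity)
          · have : ((2 : ℝ) ^ n) = N := by rw [hN]; push_cast; rfl
            rw [this, hPN]; linarith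
          · linarith
        _ = _ := by
          rw [← Real.rpow_natCast, ← Real.rpow_natCast, ← Real.rpow_mul (by norm_num), ← Real.rpow_mul (by norm_num)]
          congr 1; ring
    have g1 := hθle θ1 (min_le_left _ _)
    have g2 := hθle θ2 (min_le_right _ _)
    set X := ((2 : ℝ) ^ (-θ)) ^ n with hX
    have hX0 : 0 ≤ X := by positivity
    have m1 : (P ^ (1 - δ)) ^ (2 * (t - s)) * (J k s (2 * N) : ℝ) ≤ C * X * P ^ (2 * (t : ℝ) - kap k) := by
      calc (P ^ (1 - δ)) ^ (2 * (t - s)) * (J k s (2 * N) : ℝ) ≤ (P ^ (1 - δ)) ^ (2 * (t - s)) * (C * P ^ (2 * (s : ℝ) - kap k + η)) := by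
            gcongr
            exact hJ _ (by omega)
        _ = C * P ^ (-θ2) * P ^ (2 * (t : ℝ) - kap k) := by
            have : (P ^ (1 - δ)) ^ (2 * (t - s)) * P ^ (2 * (s : ℝ) - kap k + η) = P ^ (-θ2) * P ^ (2 * (t : ℝ) - kap k) := by
              rw [← Real.rpow_natCast, ← Real.rpow_mul hP0.le, ← Real.rpow_add hP0, ← Real.rpow_add hP0]
              congr 1
              rw [hθ2]; push_cast [Nat.cast_sub hst]; ring
            linear_combination C * this
        _ ≤ _ := by gcongr
    have m2 : ((1 + 2 * (c0 * P ^ (-θ1))) * 2) ^ (2 * t) * (2 : ℝ) ^ (-kap k) * J k t N ≤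
        (1 + ((1 + 2 * c0) ^ (2 * t) - 1) * X) * u n * P ^ (2 * (t : ℝ) - kap k) := by
      have e1 : (2 : ℝ) ^ (2 * t) * (2 : ℝ) ^ (-kap k) * J k t N = u n * P ^ (2 * (t : ℝ) - kap k) := by
        rw [hPN, Real.mul_rpow (by norm_num) hN0.le]
        have : (J k t N : ℝ) = u n * (N : ℝ) ^ (2 * (t : ℝ) - kap k) := by
          exact (div_mul_cancel₀ _ (by positivity)).symm
        rw [this]
        have : (2 : ℝ) ^ (2 * t) * (2 : ℝ) ^ (-kap k) = 2 ^ (2 * (t : ℝ) - kap k) := by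
          rw [← Real.rpow_natCast, ← Real.rpow_add (by norm_num)]; congr 1
          push_cast; ring
        rw [this]; ring
      have hun : 0 ≤ u n := by rw [hu]; positivity
      have hx1 : P ^ (-θ1) ≤ 1 := Real.rpow_le_one_of_one_le_of_nonpos hP1 (by linarith)
      calc ((1 + 2 * (c0 * P ^ (-θ1))) * 2) ^ (2 * t) * (2 : ℝ) ^ (-kap k) * J k t N =
            (1 + 2 * c0 * P ^ (-θ1)) ^ (2 * t) * (u n * P ^ (2 * (t : ℝ) - kap k)) := by
            rw [← e1, mul_pow]; ring
        _ ≤ (1 + ((1 + 2 * c0) ^ (2 * t) - 1) * P ^ (-θ1)) * (u n * P ^ (2 * (t : ℝ) - kap k)) := by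
            gcongr
            exact pow_lin _ _ (by positivity) (by positivity) hx1 _
        _ ≤ (1 + ((1 + 2 * c0) ^ (2 * t) - 1) * X) * (u n * P ^ (2 * (t : ℝ) - kap k)) := by gcongr
        _ = _ := by ring
    have hun : 0 ≤ u n := by rw [hu]; positivity
    have e3 : u (n + 1) = (J k t (2 * N) : ℝ) / P ^ (2 * (t : ℝ) - kap k) := by
      simp only [hu]; rw [e0]
    rw [e3, div_le_iff₀ hd0]
    refine hst'.trans ((add_le_add m1 m2).trans ?_)
    rw [← add_mul]
    refine mul_le_mul_of_nonneg_right ?_ hd0.le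
    rw [hA]
    have := mul_nonneg (mul_nonneg hC.le hX0) hun
    have := mul_nonneg hA1 hX0
    nlinarith)
  refine ⟨B * 2 ^ (2 * (t : ℝ) - kap k), by positivity, ?_⟩
  intro P hP
  have hP0 : (0 : ℝ) < P := by exact_mod_cast hP
  have h1 : P ≤ 2 ^ Nat.clog 2 P := Nat.le_pow_clog (by norm_num) P
  have h2 : 2 ^ Nat.clog 2 P ≤ 2 * P := by
    by_cases hp : P = 1
    · subst hp; simp
    · have h3 := Nat.pow_pred_clog_lt_self (b := 2) (by norm_num) (x := P) (by omega)
      have h4 : 0 < Nat.clog 2 P := Nat.clog_pos (by norm_num) (by omega)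
      obtain ⟨m, hm⟩ : ∃ m, Nat.clog 2 P = m + 1 := ⟨Nat.clog 2 P - 1, by omega⟩
      rw [hm] at h3 ⊢
      simp at h3
      rw [pow_succ]; omega
  set n := Nat.clog 2 P
  have h3 := huB n
  simp only [hu] at h3
  rw [div_le_iff₀ (by positivity)] at h3
  calc (J k t P : ℝ) ≤ J k t (2 ^ n) := by exact_mod_cast J_mono h1
    _ ≤ B * ((2 ^ n : ℕ) : ℝ) ^ (2 * (t : ℝ) - kap k) := h3
    _ ≤ B * (2 * (P : ℝ)) ^ (2 * (t : ℝ) - kap k) := by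
      gcongr
      exact_mod_cast h2
    _ = _ := by rw [Real.mul_rpow (by norm_num) hP0.le]; ring

end TV

noncomputable section TV

open Finset MeasureTheory

lemma sharp_all : ∃ c : ℕ, 0 < c ∧ ∀ k : ℕ, 2 ≤ k → ∃ t : ℕ, (t : ℝ) ≤ c * (k : ℝ) ^ 2 * Real.log k ∧ kap k ≤ 2 * t ∧
    ∃ C', 0 < C' ∧ ∀ P : ℕ, 1 ≤ P → (J k t P : ℝ) ≤ C' * (P : ℝ) ^ (2 * (t : ℝ) - kap k) := by
  obtain ⟨c, hc, h⟩ := vmvt_weak 12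
  refine ⟨2 * c, by omega, fun k hk => ?_⟩
  obtain ⟨s, hs1, hs2, C, hC, hJ⟩ := h k hk
  have hk' : (2 : ℝ) ≤ k := by exact_mod_cast hk
  have hs1' : (k : ℝ) ^ 2 ≤ s := by exact_mod_cast hs1
  have hks : (k : ℝ) ≤ s := by nlinarith
  have hs4 : (4 : ℝ) ≤ s := by nlinarith
  have hκ : kap k ≤ 2 * (2 * s : ℕ) := by unfold kap; push_cast; nlinarith
  refine ⟨2 * s, by push_cast; linarith, hκ, ?_⟩
  set ε : ℝ := 1 / (16 * ((2 * k + 6) * (k + 2))) with hε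
  have hε0 : 0 < ε := by positivity
  have hσ : ε * ((2 * k + 6) * (k + 2)) = 1 / 16 := by rw [hε]; field_simp
  have hε1 : ε ≤ 1 / 16 := by nlinarith
  set δ : ℝ := ε / (8 * s) with hδ
  have hδs : δ * s = ε / 8 := by rw [hδ]; field_simp
  have hδ0 : 0 < δ := by positivity
  have hη : 1 / (k : ℝ) ^ 12 < ε / 4 := by
    have e : ε / 4 = 1 / (64 * ((2 * k + 6) * (k + 2))) := by rw [hε]; field_simp; norm_num
    rw [e]
    apply one_div_lt_one_div_of_lt (by positivity)
    have h10 : (2 : ℝ) ^ 10 ≤ (k : ℝ) ^ 10 := pow_le_pow_left₀ (by norm_num) hk' 10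
    have : (k : ℝ) ^ 12 = k ^ 10 * k ^ 2 := by ring
    rw [this]
    calc 64 * ((2 * (k : ℝ) + 6) * (k + 2)) ≤ 64 * ((5 * k) * (2 * k)) := by gcongr <;> linarith
      _ = 640 * (k : ℝ) ^ 2 := by ring
      _ < 2 ^ 10 * (k : ℝ) ^ 2 := by
        have : (0 : ℝ) < (k : ℝ) ^ 2 := by positivity
        nlinarith
      _ ≤ _ := by gcongr
  refine sharp hk s (2 * s) C (1 / (k : ℝ) ^ 12) ε δ hC hδ0 ?_ hε0 ?_ ?_ hσ.le (by omega) ?_ hκ hJ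
  · nlinarith
  · nlinarith
  · have : δ * k ≤ δ * s := by gcongr
    nlinarith
  · push_cast
    nlinarith

lemma J_one (M : ℕ) : J 1 1 M ≤ M := by
  unfold J Jx En Cn
  refine le_trans ?_ (show (Icc 1 M).card ≤ M by simp)
  refine card_le_card_of_injOn (fun p => p.1 0) ?_ ?_
  · intro p hp
    simp only [coe_filter, mem_product, Fintype.mem_piFinset, Set.mem_ofPred_eq] at hp
    exact hp.1.1 0
  · intro p hp p' hp' h
    simp only [coe_filter, mem_product, Fintype.mem_piFinset, Set.mem_ofPred_eq] at hp hp'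
    have h1 := congrFun hp.2 0
    have h2 := congrFun hp'.2 0
    simp [pv] at h1 h2
    dsimp only at h
    refine Prod.ext (funext fun i => ?_) (funext fun i => ?_)
    · rw [Subsingleton.elim i 0]; exact h
    · rw [Subsingleton.elim i 0]; omega

lemma card_J (k K M : ℕ) : Nat.card {p : (Fin K → ℕ) × (Fin K → ℕ) //
            (∀ a, p.1 a ∈ Finset.Icc 1 M) ∧ (∀ a, p.2 a ∈ Finset.Icc 1 M) ∧
            ∀ i ∈ Finset.Icc 1 k, ∑ a, (p.1 a : ℤ) ^ i = ∑ a, (p.2 a : ℤ) ^ i} = J k K M := by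
  unfold J Jx En Cn
  apply Nat.subtype_card
  rintro ⟨x, y⟩
  simp only [mem_filter, mem_product, Fintype.mem_piFinset, and_assoc]
  refine and_congr_right fun _ => and_congr_right fun _ => ?_
  rw [funext_iff]
  simp only [Finset.sum_apply, pv]
  constructor
  · intro h i hi
    rw [mem_Icc] at hi
    have := h ⟨i - 1, by omega⟩
    simpa [Nat.sub_add_cancel hi.1] using this
  · intro h j
    exact h _ (mem_Icc.2 ⟨by omega, by omega⟩)

lemma final_aux : ∃ C : ℝ, 0 < C ∧ ∀ k : ℕ, 1 ≤ k →
      ∃ Ck : ℝ, 0 < Ck ∧ ∀ K M : ℕ, (K : ℝ) > C * (k : ℝ) ^ 2 * Real.log k →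
        (J k K M : ℝ) ≤ Ck * (M : ℝ) ^ (2 * K - k * (k + 1) / 2) := by
  obtain ⟨c, hc, h⟩ := sharp_all
  refine ⟨c, by exact_mod_cast hc, fun k hk => ?_⟩
  have hK1 : ∀ K : ℕ, (K : ℝ) > c * (k : ℝ) ^ 2 * Real.log k → 1 ≤ K := by
    intro K hK
    have : (0 : ℝ) ≤ c * (k : ℝ) ^ 2 * Real.log k := by
      have := Real.log_natCast_nonneg k
      positivity
    have : (0 : ℝ) < K := by linarith
    exact_mod_cast this
  by_cases hk2 : 2 ≤ k
  · obtain ⟨t, ht, hκ, C', hC', hJ⟩ := h k hk2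
    refine ⟨C', hC', fun K M hK => ?_⟩
    have hK1' := hK1 K hK
    rcases Nat.eq_zero_or_pos M with rfl | hM
    · have := J_trivial k K 0
      rw [zero_pow (by omega)] at this
      rw [Nat.le_zero.1 this]
      simp only [Nat.cast_zero]
      positivity
    · have htK : t < K := by
        have : (t : ℝ) < K := by linarith
        exact_mod_cast this
      have hM0 : (0 : ℝ) < M := by exact_mod_cast hM
      have h1 := J_mono_add k t (K - t) M
      rw [Nat.add_sub_cancel' htK.le] at h1
      have hle : k * (k + 1) / 2 ≤ 2 * K := by
        have h2 : ((k * (k + 1) / 2 : ℕ) : ℝ) ≤ (2 * t : ℕ) := by rw [kap_nat]; push_cast; exact hκ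
        have h3 : k * (k + 1) / 2 ≤ 2 * t := by exact_mod_cast h2
        omega
      calc (J k K M : ℝ) ≤ (M : ℝ) ^ (2 * (K - t)) * J k t M := h1
        _ ≤ (M : ℝ) ^ (2 * (K - t)) * (C' * (M : ℝ) ^ (2 * (t : ℝ) - kap k)) := by
          gcongr; exact hJ M hM
        _ = C' * ((M : ℝ) ^ (2 * (K - t)) * (M : ℝ) ^ (2 * (t : ℝ) - kap k)) := by ring
        _ = _ := by
          congr 1
          rw [← Real.rpow_natCast, ← Real.rpow_natCast, ← Real.rpow_add hM0, Nat.cast_sub hle, kap_nat]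
          congr 1
          push_cast [Nat.cast_sub htK.le]; ring
  · have hk1 : k = 1 := by omega
    subst hk1
    refine ⟨1, one_pos, fun K M hK => ?_⟩
    have hK1' := hK1 K hK
    have h1 := J_mono_add 1 1 (K - 1) M
    rw [Nat.add_sub_cancel' hK1'] at h1
    have h2 : (J 1 1 M : ℝ) ≤ M := by exact_mod_cast J_one M
    calc (J 1 K M : ℝ) ≤ (M : ℝ) ^ (2 * (K - 1)) * J 1 1 M := h1
      _ ≤ (M : ℝ) ^ (2 * (K - 1)) * M := by gcongr
      _ = (M : ℝ) ^ (2 * (K - 1) + 1) := by rw [pow_succ]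
      _ = _ := by rw [one_mul]; congr 1; omega

end TV

theorem tarry_vinogradov :
    ∃ C : ℝ, 0 < C ∧ ∀ k : ℕ, 1 ≤ k →
      ∃ Ck : ℝ, 0 < Ck ∧ ∀ K M : ℕ, (K : ℝ) > C * (k : ℝ) ^ 2 * Real.log k →
        (Nat.card {p : (Fin K → ℕ) × (Fin K → ℕ) //
            (∀ a, p.1 a ∈ Finset.Icc 1 M) ∧ (∀ a, p.2 a ∈ Finset.Icc 1 M) ∧
            ∀ i ∈ Finset.Icc 1 k, ∑ a, (p.1 a : ℤ) ^ i = ∑ a, (p.2 a : ℤ) ^ i} : ℝ)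
          ≤ Ck * (M : ℝ) ^ (2 * K - k * (k + 1) / 2) := by
  simp only [card_J]
  exact final_aux
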